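/- Let F be a finite field with q elements, ψ a nontrivial additive character of F, n > 1, and π an irreducible generic complex representation of GL_n(F). Then for every m with 1 ≤ m < n and every g ∈ GL_m(F): J_{π,ψ}(w_n(g)) = (|U_m|/|GL_m(F)|) · Σ_σ dim(σ) · ( |U_m|^{-1} · Σ_{h ∈ GL_m(F)} J_{π,ψ}(w_n(h)) · conj(J_{σ,ψ}(h)) ) · J_{σ,ψ}(g), where σ runs over the isomorphism classes of irreducible generic representations of GL_m(F), conj denotes complex conjugation, and for h ∈ GL_m(F), w_n(h) ∈ GL_n(F) denotes the block matrix with the identity I_{n−m} in the upper-right corner, h in the lower-left corner, and zero blocks elsewhere. -/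

import Mathlib

noncomputable section

open scoped BigOperators

/-- The predicate of being an upper unitriangular matrix. -/
def IsUnipUpper {F : Type} [Field F] {N : ℕ} (u : Matrix (Fin N) (Fin N) F) : Prop :=
  (∀ i, u i i = 1) ∧ ∀ i j : Fin N, (j : ℕ) < (i : ℕ) → u i j = 0

/-- The extension of an additive character `ψ` to (unitriangular) matrices:
`u ↦ ψ (u 1 2 + u 2 3 + ⋯)`. -/
def psiU {F : Type} [Field F] (ψ : AddChar F ℂ) {N : ℕ} (u : Matrix (Fin N) (Fin N) F) : ℂ :=
  ψ (∑ i : Fin (N - 1),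
      u ⟨(i : ℕ), lt_of_lt_of_le i.isLt (Nat.sub_le N 1)⟩
        ⟨(i : ℕ) + 1, by have := i.isLt; omega⟩)

/-- A finite-dimensional complex (matrix) representation of `GL_N(F)`. -/
structure FinRep (N : ℕ) (F : Type) [Field F] where
  d : ℕ
  ρ : (Matrix (Fin N) (Fin N) F)ˣ →* (Matrix (Fin d) (Fin d) ℂ)ˣ

/-- Irreducibility: the space is nonzero and has no nontrivial invariant subspace. -/
def FinRep.Irreducible {N : ℕ} {F : Type} [Field F] (π : FinRep N F) : Prop :=
  0 < π.d ∧ ∀ W : Submodule ℂ (Fin π.d → ℂ),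
    (∀ g : (Matrix (Fin N) (Fin N) F)ˣ, ∀ v ∈ W,
        ((π.ρ g : Matrix (Fin π.d) (Fin π.d) ℂ)).mulVec v ∈ W) →
      W = ⊥ ∨ W = ⊤

/-- Genericity: there is a nonzero `ψ`-Whittaker functional. -/
def FinRep.Generic {N : ℕ} {F : Type} [Field F] (ψ : AddChar F ℂ) (π : FinRep N F) : Prop :=
  ∃ ℓ : (Fin π.d → ℂ) →ₗ[ℂ] ℂ, ℓ ≠ 0 ∧
    ∀ u : (Matrix (Fin N) (Fin N) F)ˣ, IsUnipUpper (u : Matrix (Fin N) (Fin N) F) →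
      ∀ v : Fin π.d → ℂ,
        ℓ (((π.ρ u : Matrix (Fin π.d) (Fin π.d) ℂ)).mulVec v) =
          psiU ψ (u : Matrix (Fin N) (Fin N) F) * ℓ v

/-- Isomorphism of two such representations. -/
def FinRep.Iso {N : ℕ} {F : Type} [Field F] (π σ : FinRep N F) : Prop :=
  ∃ e : (Fin π.d → ℂ) ≃ₗ[ℂ] (Fin σ.d → ℂ),
    ∀ (g : (Matrix (Fin N) (Fin N) F)ˣ) (v : Fin π.d → ℂ),
      e (((π.ρ g : Matrix (Fin π.d) (Fin π.d) ℂ)).mulVec v) =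
        ((σ.ρ g : Matrix (Fin σ.d) (Fin σ.d) ℂ)).mulVec (e v)

open scoped Classical in
/-- The set `U_N` of upper unitriangular matrices. -/
def unipFinset (F : Type) [Field F] [Fintype F] (N : ℕ) :
    Finset (Matrix (Fin N) (Fin N) F) :=
  Finset.univ.filter IsUnipUpper

open scoped Classical in
/-- The trace character of `π`, extended by zero to all matrices. -/
def traceChar {F : Type} [Field F] {N : ℕ} (π : FinRep N F) (A : Matrix (Fin N) (Fin N) F) : ℂ :=
  if h : IsUnit A then Matrix.trace ((π.ρ h.unit : Matrix (Fin π.d) (Fin π.d) ℂ)) else 0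

/-- The normalized Bessel function of `π` (S. I. Gelfand's formula), extended by zero to
all matrices. -/
def Bessel {F : Type} [Field F] [Fintype F] {N : ℕ}
    (ψ : AddChar F ℂ) (π : FinRep N F) (A : Matrix (Fin N) (Fin N) F) : ℂ :=
  ((unipFinset F N).card : ℂ)⁻¹ *
    ∑ u ∈ unipFinset F N, (psiU ψ u)⁻¹ * traceChar π (A * u)

/-- The `N × N` block matrix with `a·I_{N-M}` in the upper-right corner, an `M × M` matrix `h`
in the lower-left corner, and zero blocks elsewhere. -/
def cornerBlock (F : Type) [Field F] (N M : ℕ) (a : F) (h : Matrix (Fin M) (Fin M) F) :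
    Matrix (Fin N) (Fin N) F :=
  fun i j =>
    if (i : ℕ) < N - M then (if (j : ℕ) = (i : ℕ) + M then a else 0)
    else if hi : (i : ℕ) - (N - M) < M then
      (if hj : (j : ℕ) < M then h ⟨(i : ℕ) - (N - M), hi⟩ ⟨(j : ℕ), hj⟩ else 0)
    else 0

end

open scoped MatrixGroups

noncomputable section

section Unipotent

variable {F : Type} [Field F] {N : ℕ}

lemma IsUnipUpper.mul_apply_succ {u v : Matrix (Fin N) (Fin N) F} (hu : IsUnipUpper u)
    (hv : IsUnipUpper v) {i j : Fin N} (hij : (j : ℕ) = i + 1) :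
    (u * v) i j = u i j + v i j := by
  have hne : i ≠ j := by rintro rfl; omega
  rw [Matrix.mul_apply, Finset.sum_eq_add i j hne]
  · rw [hu.1, hv.1]; ring
  · rintro k - ⟨h1, h2⟩
    rcases lt_or_ge (k : ℕ) (i : ℕ) with h | h
    · rw [hu.2 i k h, zero_mul]
    · have : (k : ℕ) ≠ i := fun h => h1 (Fin.ext h)
      have : (k : ℕ) ≠ j := fun h => h2 (Fin.ext h)
      rw [hv.2 k j (by omega), mul_zero]
  · simp
  · simp

lemma IsUnipUpper.one : IsUnipUpper (1 : Matrix (Fin N) (Fin N) F) :=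
  ⟨fun i => Matrix.one_apply_eq i, fun i j h => Matrix.one_apply_ne (by rintro rfl; omega)⟩

lemma IsUnipUpper.mul {u v : Matrix (Fin N) (Fin N) F} (hu : IsUnipUpper u)
    (hv : IsUnipUpper v) : IsUnipUpper (u * v) := by
  constructor
  · intro i
    rw [Matrix.mul_apply, Finset.sum_eq_single i, hu.1, hv.1, one_mul]
    · intro k _ hk
      rcases lt_or_gt_of_ne hk with h | h
      · rw [hu.2 i k h, zero_mul]
      · rw [hv.2 k i h, mul_zero]
    · simp
  · intro i j hij
    rw [Matrix.mul_apply]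
    refine Finset.sum_eq_zero fun k _ => ?_
    rcases lt_or_ge (k : ℕ) (i : ℕ) with h | h
    · rw [hu.2 i k h, zero_mul]
    · rw [hv.2 k j (by omega), mul_zero]

lemma IsUnipUpper.isUnit {u : Matrix (Fin N) (Fin N) F} (hu : IsUnipUpper u) : IsUnit u := by
  rw [Matrix.isUnit_iff_isUnit_det, Matrix.det_of_isUpperTriangular (fun i j h => hu.2 i j h)]
  simp [hu.1]

lemma psiU_mul (ψ : AddChar F ℂ) {u v : Matrix (Fin N) (Fin N) F} (hu : IsUnipUpper u)
    (hv : IsUnipUpper v) : psiU ψ (u * v) = psiU ψ u * psiU ψ v := by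
  rw [psiU, psiU, psiU, ← AddChar.map_add_eq_mul, ← Finset.sum_add_distrib]
  congr 1
  exact Finset.sum_congr rfl fun i _ => hu.mul_apply_succ hv rfl

lemma psiU_one (ψ : AddChar F ℂ) : psiU ψ (1 : Matrix (Fin N) (Fin N) F) = 1 := by
  rw [psiU, Finset.sum_eq_zero, AddChar.map_zero_eq_one]
  exact fun i _ => Matrix.one_apply_ne (by simp [Fin.ext_iff])

lemma psiU_ne_zero (ψ : AddChar F ℂ) (u : Matrix (Fin N) (Fin N) F) : psiU ψ u ≠ 0 := by
  intro h
  have h2 := AddChar.map_zero_eq_one ψ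
  rw [psiU] at h
  rw [← sub_self, AddChar.map_sub_eq_div, h, zero_div] at h2
  exact zero_ne_one h2

variable [Fintype F]

variable (F N) in
/-- The subgroup of upper unitriangular matrices. -/
def unipSubgroup : Subgroup (GL (Fin N) F) where
  carrier := {u | IsUnipUpper (u : Matrix (Fin N) (Fin N) F)}
  mul_mem' := fun hu hv => hu.mul hv
  one_mem' := IsUnipUpper.one
  inv_mem' := by
    intro u hu
    have hpow : ∀ k : ℕ, IsUnipUpper ((u ^ k : GL (Fin N) F) : Matrix (Fin N) (Fin N) F) := by
      intro k
      induction k with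
      | zero => simpa using IsUnipUpper.one
      | succ k ih => rw [pow_succ]; exact ih.mul hu
    have hinv : u⁻¹ = u ^ (orderOf u - 1) := by
      rw [inv_eq_iff_mul_eq_one, ← pow_succ', Nat.sub_add_cancel (orderOf_pos u),
        pow_orderOf_eq_one]
    rw [Set.mem_ofPred_eq, hinv]
    exact hpow _

lemma mem_unipSubgroup {u : GL (Fin N) F} :
    u ∈ unipSubgroup F N ↔ IsUnipUpper (u : Matrix (Fin N) (Fin N) F) := Iff.rfl

instance : Fintype (unipSubgroup F N) := Fintype.ofFinite _

lemma sum_unipFinset (φ : Matrix (Fin N) (Fin N) F → ℂ) :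
    ∑ u ∈ unipFinset F N, φ u = ∑ u : unipSubgroup F N, φ (u : GL (Fin N) F) := by
  symm
  refine Finset.sum_bij (fun u _ => ((u : GL (Fin N) F) : Matrix (Fin N) (Fin N) F))
    ?_ ?_ ?_ ?_
  · intro u _
    simp only [unipFinset, Finset.mem_filter_univ]
    exact u.2
  · intro u _ v _ h
    exact Subtype.ext (Units.ext h)
  · intro b hb
    have hb' : IsUnipUpper b := by simpa [unipFinset] using hb
    exact ⟨⟨hb'.isUnit.unit, hb'⟩, Finset.mem_univ _, rfl⟩
  · intros; rfl

lemma card_unipFinset : (unipFinset F N).card = Fintype.card (unipSubgroup F N) := by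
  have h := sum_unipFinset (F := F) (N := N) (fun _ => 1)
  simp only [Finset.sum_const, nsmul_eq_mul, mul_one, Finset.card_univ] at h
  exact_mod_cast h

/-- The restriction of `psiU ψ` to the group of unitriangular matrices. -/
def whittakerChar (ψ : AddChar F ℂ) : unipSubgroup F N →* ℂ where
  toFun u := psiU ψ ((u : GL (Fin N) F) : Matrix (Fin N) (Fin N) F)
  map_one' := psiU_one ψ
  map_mul' u v := psiU_mul ψ u.2 v.2

lemma whittakerChar_ne_zero (ψ : AddChar F ℂ) (u : unipSubgroup F N) :
    whittakerChar ψ u ≠ 0 := psiU_ne_zero ψ _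

lemma norm_whittakerChar (ψ : AddChar F ℂ) (u : unipSubgroup F N) :
    ‖whittakerChar ψ u‖ = 1 := by
  refine Complex.norm_eq_one_of_pow_eq_one (n := orderOf u) ?_ (orderOf_pos u).ne'
  rw [← map_pow, pow_orderOf_eq_one, map_one]

lemma conj_whittakerChar (ψ : AddChar F ℂ) (u : unipSubgroup F N) :
    (starRingEnd ℂ) (whittakerChar ψ u) = (whittakerChar ψ u)⁻¹ := by
  rw [Complex.inv_def, Complex.normSq_eq_norm_sq, norm_whittakerChar]; simp

end Unipotent

section Bessel

variable {F : Type} [Field F] {N : ℕ}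

lemma traceChar_coe (π : FinRep N F) (g : GL (Fin N) F) :
    traceChar π (g : Matrix (Fin N) (Fin N) F) =
      Matrix.trace (π.ρ g : Matrix (Fin π.d) (Fin π.d) ℂ) := by
  rw [traceChar, dif_pos g.isUnit]
  congr 3
  exact Units.ext rfl

lemma traceChar_mul_comm (π : FinRep N F) (g : GL (Fin N) F) (A : Matrix (Fin N) (Fin N) F) :
    traceChar π ((g : Matrix (Fin N) (Fin N) F) * A) =
      traceChar π (A * (g : Matrix (Fin N) (Fin N) F)) := by
  by_cases hA : IsUnit A
  · obtain ⟨a, rfl⟩ := hA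
    rw [← Units.val_mul, ← Units.val_mul, traceChar_coe, traceChar_coe, map_mul, map_mul,
      Units.val_mul, Units.val_mul, Matrix.trace_mul_comm]
  · rw [traceChar, traceChar, dif_neg, dif_neg]
    · rwa [Units.isUnit_mul_units]
    · rwa [Units.isUnit_units_mul]

variable [Fintype F]

lemma Bessel_eq (ψ : AddChar F ℂ) (π : FinRep N F) (A : Matrix (Fin N) (Fin N) F) :
    Bessel ψ π A = (Fintype.card (unipSubgroup F N) : ℂ)⁻¹ *
      ∑ u : unipSubgroup F N, (whittakerChar ψ u)⁻¹ *
        traceChar π (A * ((u : GL (Fin N) F) : Matrix (Fin N) (Fin N) F)) := by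
  rw [Bessel, sum_unipFinset (fun u => (psiU ψ u)⁻¹ * traceChar π (A * u)), card_unipFinset]
  rfl

lemma Bessel_mul_unip (ψ : AddChar F ℂ) (π : FinRep N F) (A : Matrix (Fin N) (Fin N) F)
    (v : unipSubgroup F N) :
    Bessel ψ π (A * ((v : GL (Fin N) F) : Matrix (Fin N) (Fin N) F)) =
      whittakerChar ψ v * Bessel ψ π A := by
  rw [Bessel_eq, Bessel_eq, mul_left_comm]
  congr 1
  rw [Finset.mul_sum]
  refine Eq.trans ?_ (Equiv.sum_comp (Equiv.mulLeft v) _)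
  refine Finset.sum_congr rfl fun u _ => ?_
  have := whittakerChar_ne_zero ψ v
  simp only [Equiv.coe_mulLeft, map_mul, mul_inv, Subgroup.coe_mul, Units.val_mul, Matrix.mul_assoc]
  field_simp

lemma Bessel_unip_mul (ψ : AddChar F ℂ) (π : FinRep N F) (A : Matrix (Fin N) (Fin N) F)
    (v : unipSubgroup F N) :
    Bessel ψ π (((v : GL (Fin N) F) : Matrix (Fin N) (Fin N) F) * A) =
      whittakerChar ψ v * Bessel ψ π A := by
  rw [Bessel_eq, Bessel_eq, mul_left_comm]
  congr 1
  rw [Finset.mul_sum]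
  refine Eq.trans ?_ (Equiv.sum_comp (Equiv.mulRight v) _)
  refine Finset.sum_congr rfl fun u _ => ?_
  have := whittakerChar_ne_zero ψ v
  simp only [Equiv.coe_mulRight, map_mul, mul_inv, Subgroup.coe_mul, Units.val_mul,
    Matrix.mul_assoc, traceChar_mul_comm π v]
  field_simp

/-- Bi-equivariance of a function on `GL_N(F)` under the unitriangular group. -/
def IsWhittaker (ψ : AddChar F ℂ) (f : GL (Fin N) F → ℂ) : Prop :=
  ∀ (u : unipSubgroup F N) (g : GL (Fin N) F),
    f (u * g) = whittakerChar ψ u * f g ∧ f (g * u) = whittakerChar ψ u * f g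

lemma isWhittaker_Bessel (ψ : AddChar F ℂ) (π : FinRep N F) :
    IsWhittaker ψ (fun g : GL (Fin N) F => Bessel ψ π (g : Matrix (Fin N) (Fin N) F)) :=
  fun u g => ⟨Bessel_unip_mul ψ π g u, Bessel_mul_unip ψ π g u⟩

end Bessel

namespace FinRep

open Matrix

variable {F : Type} [Field F] {N : ℕ}

/-- The extension of a representation to the group algebra. -/
def algHom (τ : FinRep N F) :
    MonoidAlgebra ℂ (GL (Fin N) F) →ₐ[ℂ] Matrix (Fin τ.d) (Fin τ.d) ℂ :=
  MonoidAlgebra.lift ℂ _ _ ((Units.coeHom _).comp τ.ρ)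

@[simp]
lemma algHom_single (τ : FinRep N F) (g : GL (Fin N) F) (c : ℂ) :
    τ.algHom (MonoidAlgebra.single g c) = c • (τ.ρ g : Matrix (Fin τ.d) (Fin τ.d) ℂ) := by
  simp [algHom]

/-- An idempotent of the group algebra whose corner algebra is commutative acts on every
irreducible representation with corner algebra consisting of scalars. -/
lemma Irreducible.exists_algHom_eq_smul {τ : FinRep N F} (hτ : τ.Irreducible)
    {e : MonoidAlgebra ℂ (GL (Fin N) F)} (he : e * e = e)
    (hcomm : ∀ x y, (e * x * e) * (e * y * e) = (e * y * e) * (e * x * e))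
    {a : MonoidAlgebra ℂ (GL (Fin N) F)} (ha : e * a * e = a) :
    ∃ c : ℂ, τ.algHom a = c • τ.algHom e := by
  set T := τ.algHom a with hT
  set E := τ.algHom e with hE
  have hEE : E * E = E := by rw [hE, ← map_mul, he]
  have hea : e * a = a := by rw [← ha, ← mul_assoc, ← mul_assoc, he]
  have hae : a * e = a := by rw [← ha, mul_assoc, he]
  have hET : E * T = T := by rw [hE, hT, ← map_mul, hea]
  have hTE : T * E = T := by rw [hE, hT, ← map_mul, hae]
  by_cases hE0 : E = 0
  · exact ⟨0, by rw [← hET, hE0, zero_mul, smul_zero]⟩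
  have hmaps : ∀ v ∈ LinearMap.range E.mulVecLin, T.mulVecLin v ∈ LinearMap.range E.mulVecLin := by
    intro v _
    exact ⟨T *ᵥ v, by simp [hET]⟩
  have hne : Nontrivial (LinearMap.range E.mulVecLin) := by
    rw [Submodule.nontrivial_iff_ne_bot, ne_eq, LinearMap.range_eq_bot]
    intro h
    exact hE0 (Matrix.toLin'.injective (h.trans (map_zero _).symm))
  obtain ⟨c, hc⟩ := Module.End.exists_eigenvalue (T.mulVecLin.restrict hmaps)
  obtain ⟨⟨w, v₀, hv₀⟩, hw⟩ := hc.exists_hasEigenvector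
  have hw0 : w ≠ 0 := fun h => hw.2 (Subtype.ext h)
  have hTw : T *ᵥ w = c • w := congrArg Subtype.val hw.apply_eq_smul
  have hEw : E *ᵥ w = w := by
    rw [← hv₀]; simp [hEE]
  refine ⟨c, ?_⟩
  let W : Submodule ℂ (Fin τ.d → ℂ) :=
    { carrier := {v | ∀ x, T *ᵥ (τ.algHom x *ᵥ v) = c • (E *ᵥ (τ.algHom x *ᵥ v))}
      add_mem' := fun {u v} hu hv x => by rw [mulVec_add, mulVec_add, mulVec_add, hu x, hv x, smul_add]
      zero_mem' := fun x => by simp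
      smul_mem' := fun k v hv x => by
        rw [mulVec_smul, mulVec_smul, mulVec_smul, hv x, smul_comm] }
  have hwW : w ∈ W := by
    intro x
    have h1 : a * (e * x * e) = (e * x * e) * a := by
      have := hcomm a x
      rwa [ha] at this
    have h2 : T * τ.algHom x * E = E * τ.algHom x * T := by
      have := congrArg τ.algHom h1
      simp only [map_mul, ← hT, ← hE] at this
      rw [← mul_assoc, ← mul_assoc, hTE, mul_assoc (E * τ.algHom x), hET] at this
      exact this
    calc T *ᵥ (τ.algHom x *ᵥ w) = (T * τ.algHom x * E) *ᵥ w := by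
          rw [← mulVec_mulVec, hEw, ← mulVec_mulVec]
      _ = c • (E *ᵥ (τ.algHom x *ᵥ w)) := by
          rw [h2, ← mulVec_mulVec, hTw, mulVec_smul, ← mulVec_mulVec]
  rcases hτ.2 W (fun g v hv x => by
    have := hv (x * MonoidAlgebra.single g 1)
    rw [map_mul, algHom_single, one_smul, ← mulVec_mulVec] at this
    exact this) with h | h
  · exact absurd ((Submodule.eq_bot_iff _).1 h w hwW) hw0
  · refine Matrix.toLin'.injective (LinearMap.ext fun v => ?_)
    have hv : v ∈ W := h ▸ Submodule.mem_top
    have := hv 1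
    simpa [smul_mulVec] using this

/-- If the corner algebra of `e` acts by scalars, then `e` acts with rank at most one. -/
lemma Irreducible.exists_algHom_eq_vecMulVec {τ : FinRep N F} (hτ : τ.Irreducible)
    {e : MonoidAlgebra ℂ (GL (Fin N) F)} (he : e * e = e)
    (hcomm : ∀ x y, (e * x * e) * (e * y * e) = (e * y * e) * (e * x * e))
    (hE0 : τ.algHom e ≠ 0) :
    ∃ w l : Fin τ.d → ℂ, τ.algHom e = vecMulVec w l ∧ l ⬝ᵥ w = 1 := by
  set E := τ.algHom e with hE
  have hEE : E * E = E := by rw [hE, ← map_mul, he]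
  obtain ⟨v₀, hv₀⟩ : ∃ v₀, E *ᵥ v₀ ≠ 0 := by
    by_contra! h
    exact hE0 (Matrix.toLin'.injective (LinearMap.ext fun v => by simpa using h v))
  set w := E *ᵥ v₀ with hw
  have hEw : E *ᵥ w = w := by rw [hw, mulVec_mulVec, hEE]
  let W : Submodule ℂ (Fin τ.d → ℂ) :=
    { carrier := {v | ∀ x, E *ᵥ (τ.algHom x *ᵥ v) ∈ Submodule.span ℂ {w}}
      add_mem' := fun {u v} hu hv x => by
        rw [mulVec_add, mulVec_add]; exact add_mem (hu x) (hv x)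
      zero_mem' := fun x => by simp
      smul_mem' := fun k v hv x => by
        rw [mulVec_smul, mulVec_smul]; exact Submodule.smul_mem _ _ (hv x) }
  have hwW : w ∈ W := by
    intro x
    obtain ⟨c, hc⟩ := hτ.exists_algHom_eq_smul he hcomm (a := e * x * e)
      (by rw [← mul_assoc, ← mul_assoc, he, mul_assoc, he])
    refine Submodule.mem_span_singleton.2 ⟨c, ?_⟩
    rw [map_mul, map_mul, ← hE] at hc
    calc c • w = (E * τ.algHom x * E) *ᵥ w := by rw [hc, smul_mulVec, hEw]
      _ = E *ᵥ (τ.algHom x *ᵥ w) := by rw [← mulVec_mulVec, hEw, ← mulVec_mulVec]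
  rcases hτ.2 W (fun g v hv x => by
    have := hv (x * MonoidAlgebra.single g 1)
    rw [map_mul, algHom_single, one_smul, ← mulVec_mulVec] at this
    exact this) with h | h
  · exact absurd ((Submodule.eq_bot_iff _).1 h w hwW) hv₀
  have hspan : ∀ v, ∃ c : ℂ, c • w = E *ᵥ v := fun v => by
    have hv : v ∈ W := h ▸ Submodule.mem_top
    have := hv 1
    rw [map_one, one_mulVec] at this
    exact Submodule.mem_span_singleton.1 this
  choose l hl using hspan
  refine ⟨w, fun j => l (Pi.single j 1), ?_, ?_⟩
  · ext i j
    have := congrFun (hl (Pi.single j 1)) i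
    simp at this
    rw [vecMulVec_apply, ← this, mul_comm]
  · have hcol : E = vecMulVec w (fun j => l (Pi.single j 1)) := by
      ext i j
      have := congrFun (hl (Pi.single j 1)) i
      simp at this
      rw [vecMulVec_apply, ← this, mul_comm]
    have h1 := hEw
    rw [hcol, vecMulVec_mulVec] at h1
    obtain ⟨i, hi⟩ := Function.ne_iff.1 hv₀
    have h2 := congrFun h1 i
    simp at h2 hi
    exact (mul_eq_left₀ hi).1 h2

/-- Schur's lemma for non-isomorphic representations. -/
lemma Irreducible.intertwiner_eq_zero {σ τ : FinRep N F} (hσ : σ.Irreducible)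
    (hτ : τ.Irreducible) (hiso : ¬ σ.Iso τ) (S : Matrix (Fin τ.d) (Fin σ.d) ℂ)
    (hS : ∀ g, S * (σ.ρ g : Matrix (Fin σ.d) (Fin σ.d) ℂ) =
      (τ.ρ g : Matrix (Fin τ.d) (Fin τ.d) ℂ) * S) : S = 0 := by
  have hS' : ∀ g v, S *ᵥ ((σ.ρ g : Matrix (Fin σ.d) (Fin σ.d) ℂ) *ᵥ v) =
      (τ.ρ g : Matrix (Fin τ.d) (Fin τ.d) ℂ) *ᵥ (S *ᵥ v) := fun g v => by
    rw [mulVec_mulVec, hS, mulVec_mulVec]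
  rcases hσ.2 (LinearMap.ker S.mulVecLin) (fun g v hv => by
    simp only [LinearMap.mem_ker, mulVecLin_apply] at hv ⊢
    rw [hS', hv, mulVec_zero]) with hk | hk
  · rcases hτ.2 (LinearMap.range S.mulVecLin) (by
      rintro g _ ⟨v, rfl⟩
      exact ⟨_, hS' g v⟩) with hr | hr
    · rw [LinearMap.range_eq_bot] at hr
      exact Matrix.toLin'.injective (hr.trans (map_zero _).symm)
    · exact absurd ⟨LinearEquiv.ofBijective S.mulVecLin
        ⟨LinearMap.ker_eq_bot.1 hk, LinearMap.range_eq_top.1 hr⟩, hS'⟩ hiso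
  · rw [LinearMap.ker_eq_top] at hk
    exact Matrix.toLin'.injective (hk.trans (map_zero _).symm)

/-- Schur's lemma for endomorphisms. -/
lemma Irreducible.intertwiner_eq_smul_one {σ : FinRep N F} (hσ : σ.Irreducible)
    (S : Matrix (Fin σ.d) (Fin σ.d) ℂ)
    (hS : ∀ g, S * (σ.ρ g : Matrix (Fin σ.d) (Fin σ.d) ℂ) =
      (σ.ρ g : Matrix (Fin σ.d) (Fin σ.d) ℂ) * S) :
    ∃ c : ℂ, S = c • (1 : Matrix (Fin σ.d) (Fin σ.d) ℂ) := by
  have : Nonempty (Fin σ.d) := ⟨⟨0, hσ.1⟩⟩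
  obtain ⟨c, hc⟩ := Module.End.exists_eigenvalue (S.mulVecLin)
  obtain ⟨w, hw⟩ := hc.exists_hasEigenvector
  refine ⟨c, ?_⟩
  rcases hσ.2 (Module.End.eigenspace S.mulVecLin c) (fun g v hv => by
    rw [Module.End.mem_eigenspace_iff, mulVecLin_apply] at hv ⊢
    rw [mulVec_mulVec, hS, ← mulVec_mulVec, hv, mulVec_smul]) with h | h
  · exact absurd h hc
  · refine Matrix.toLin'.injective (LinearMap.ext fun v => ?_)
    have hv : v ∈ Module.End.eigenspace S.mulVecLin c := h ▸ Submodule.mem_top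
    rw [Module.End.mem_eigenspace_iff, mulVecLin_apply] at hv
    simpa [smul_mulVec] using hv

variable [Fintype F] [DecidableEq F]

lemma sum_intertwines (σ τ : FinRep N F) (X : Matrix (Fin τ.d) (Fin σ.d) ℂ) (g : GL (Fin N) F) :
    (∑ h : GL (Fin N) F, (τ.ρ h : Matrix (Fin τ.d) (Fin τ.d) ℂ) * X *
        (σ.ρ h⁻¹ : Matrix (Fin σ.d) (Fin σ.d) ℂ)) * (σ.ρ g : Matrix (Fin σ.d) (Fin σ.d) ℂ) =
      (τ.ρ g : Matrix (Fin τ.d) (Fin τ.d) ℂ) *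
        ∑ h : GL (Fin N) F, (τ.ρ h : Matrix (Fin τ.d) (Fin τ.d) ℂ) * X *
          (σ.ρ h⁻¹ : Matrix (Fin σ.d) (Fin σ.d) ℂ) := by
  rw [Matrix.sum_mul, Matrix.mul_sum]
  refine Eq.trans (Equiv.sum_comp (Equiv.mulLeft g) _).symm ?_
  refine Finset.sum_congr rfl fun h _ => ?_
  simp only [Equiv.coe_mulLeft, _root_.mul_inv_rev, map_mul, Units.val_mul, Matrix.mul_assoc]
  rw [← Units.val_mul (σ.ρ g⁻¹), ← map_mul, inv_mul_cancel, map_one, Units.val_one, Matrix.mul_one]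

lemma sum_eq_trace_smul {σ : FinRep N F} (hσ : σ.Irreducible)
    (X : Matrix (Fin σ.d) (Fin σ.d) ℂ) :
    ∑ h : GL (Fin N) F, (σ.ρ h : Matrix (Fin σ.d) (Fin σ.d) ℂ) * X *
        (σ.ρ h⁻¹ : Matrix (Fin σ.d) (Fin σ.d) ℂ) =
      ((Fintype.card (GL (Fin N) F) : ℂ) / σ.d * X.trace) •
        (1 : Matrix (Fin σ.d) (Fin σ.d) ℂ) := by
  obtain ⟨c, hc⟩ := hσ.intertwiner_eq_smul_one _ (sum_intertwines σ σ X)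
  have ht := congrArg Matrix.trace hc
  rw [Matrix.trace_sum, Finset.sum_congr rfl (g := fun _ => X.trace)] at ht
  · have hd : (σ.d : ℂ) ≠ 0 := by exact_mod_cast hσ.1.ne'
    rw [hc]
    congr 1
    simp at ht
    field_simp
    rw [← ht]
  · intro h _
    rw [Matrix.trace_mul_comm, ← Matrix.mul_assoc, ← Units.val_mul, ← map_mul, inv_mul_cancel,
      map_one, Units.val_one, Matrix.one_mul]

open scoped ComplexOrder in
/-- The character of an inverse is the complex conjugate. -/
lemma trace_inv (σ : FinRep N F) (g : GL (Fin N) F) :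
    Matrix.trace (σ.ρ g⁻¹ : Matrix (Fin σ.d) (Fin σ.d) ℂ) =
      (starRingEnd ℂ) (Matrix.trace (σ.ρ g : Matrix (Fin σ.d) (Fin σ.d) ℂ)) := by
  let R : GL (Fin N) F → Matrix (Fin σ.d) (Fin σ.d) ℂ := fun h => (σ.ρ h : Matrix _ _ ℂ)
  have hR : ∀ a b, R (a * b) = R a * R b := fun a b => by simp [R]
  have hR1 : R 1 = 1 := by simp [R]
  set P : Matrix (Fin σ.d) (Fin σ.d) ℂ := ∑ h : GL (Fin N) F, (R h)ᴴ * R h with hP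
  have hPpos : P.PosDef := by
    refine Matrix.posDef_sum Finset.univ_nonempty fun h _ => ?_
    refine Matrix.PosDef.conjTranspose_mul_self _ ?_
    exact Matrix.mulVec_injective_of_isUnit (σ.ρ h).isUnit
  have hinv : (R g)ᴴ * P * R g = P := by
    rw [hP, Matrix.mul_sum, Matrix.sum_mul]
    refine Eq.trans ?_ (Equiv.sum_comp (Equiv.mulRight g) _)
    refine Finset.sum_congr rfl fun h _ => ?_
    simp only [Equiv.coe_mulRight, hR, Matrix.conjTranspose_mul, Matrix.mul_assoc]
  obtain ⟨p, hp⟩ := hPpos.isUnit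
  have hkey : (R g)ᴴ * P = P * R g⁻¹ := by
    calc (R g)ᴴ * P = (R g)ᴴ * P * (R g * R g⁻¹) := by
          rw [← hR, mul_inv_cancel, hR1, Matrix.mul_one]
      _ = P * R g⁻¹ := by rw [← Matrix.mul_assoc, hinv]
  have : R g⁻¹ = (p⁻¹ : (Matrix _ _ ℂ)ˣ) * ((R g)ᴴ * P) := by
    rw [hkey, ← hp, ← Matrix.mul_assoc, Units.inv_mul, Matrix.one_mul]
  change (R g⁻¹).trace = _
  rw [this, Matrix.trace_mul_comm, ← hp, Matrix.mul_assoc, Units.mul_inv, Matrix.mul_one,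
    Matrix.trace_conjTranspose]
  rfl

end FinRep

section Bruhat

open Matrix

variable {F : Type} [Field F] {N : ℕ}

lemma IsUnipUpper.one_add {M : Matrix (Fin N) (Fin N) F} (hM : ∀ i j, j ≤ i → M i j = 0) :
    IsUnipUpper (1 + M) := by
  constructor
  · intro i
    simp [hM i i le_rfl]
  · intro i j hij
    have : i ≠ j := by rintro rfl; omega
    simp [hM i j (Fin.le_def.2 hij.le), Matrix.one_apply_ne this]

lemma psiU_one_add_single (ψ : AddChar F ℂ) (a b : Fin N) (x : F) :
    psiU ψ (1 + Matrix.single a b x) = if (b : ℕ) = a + 1 then ψ x else 1 := by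
  rw [psiU]
  split_ifs with h
  · congr 1
    rw [Finset.sum_eq_single ⟨(a : ℕ), by omega⟩]
    · have h1 : (⟨(a : ℕ) + 1, by omega⟩ : Fin N) = b := Fin.ext h.symm
      simp only [Fin.eta, h1, Matrix.add_apply]
      rw [Matrix.one_apply_ne (by rintro rfl; omega), Matrix.single_apply_same, zero_add]
    · intro i _ hi
      rw [Matrix.add_apply, Matrix.one_apply_ne (by simp [Fin.ext_iff]),
        Matrix.single_apply_of_row_ne, add_zero]
      rintro rfl
      exact hi rfl
    · simp
  · rw [Finset.sum_eq_zero, AddChar.map_zero_eq_one]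
    intro i _
    rw [Matrix.add_apply, Matrix.one_apply_ne (by simp [Fin.ext_iff]), zero_add,
      Matrix.single_apply, if_neg]
    rintro ⟨rfl, rfl⟩
    exact h rfl

lemma exists_partial_monomial (g : Matrix (Fin N) (Fin N) F) (hg : IsUnit g) (k : ℕ) :
    k ≤ N → ∃ u v : Matrix (Fin N) (Fin N) F, IsUnipUpper u ∧ IsUnipUpper v ∧
      ∃ p : Fin N → Fin N, ∀ j : Fin N, (j : ℕ) < k →
        (u * g * v) (p j) j ≠ 0 ∧ (∀ i, i ≠ p j → (u * g * v) i j = 0) ∧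
          ∀ l, l ≠ j → (u * g * v) (p j) l = 0 := by
  induction k with
  | zero => exact fun _ => ⟨1, 1, .one, .one, id, fun j hj => absurd hj (by omega)⟩
  | succ k ih =>
    intro hk
    obtain ⟨u, v, hu, hv, p, hp⟩ := ih (by omega)
    set M := u * g * v with hM
    have hMu : IsUnit M := (hu.isUnit.mul hg).mul hv.isUnit
    let κ : Fin N := ⟨k, hk⟩
    have hcol : ∃ r, M r κ ≠ 0 := by
      by_contra! h
      have h1 : M *ᵥ Pi.single κ 1 = M *ᵥ 0 := by
        ext i; simp [h i]
      have h2 := congrFun (Matrix.mulVec_injective_of_isUnit hMu h1) κ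
      simp at h2
    obtain ⟨r, hr, hmax⟩ : ∃ r, M r κ ≠ 0 ∧ ∀ i, r < i → M i κ = 0 := by
      classical
      obtain ⟨r₀, hr₀⟩ := hcol
      obtain ⟨r, hr, hmax⟩ := Finset.exists_max_image
        (Finset.univ.filter fun r => M r κ ≠ 0) id ⟨r₀, by simpa using hr₀⟩
      refine ⟨r, by simpa using hr, fun i hi => ?_⟩
      by_contra h
      exact absurd (hmax i (by simpa using h)) (not_le.2 hi)
    have hrp : ∀ j : Fin N, (j : ℕ) < k → r ≠ p j := by
      rintro j hj rfl
      exact hr ((hp j hj).2.2 κ (by rintro rfl; simp [κ] at hj))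
    let c : Fin N → F := fun i => if i < r then -M i κ / M r κ else 0
    let d : Fin N → F := fun j => if κ < j then -M r j / M r κ else 0
    let u' : Matrix (Fin N) (Fin N) F := 1 + vecMulVec c (Pi.single r 1)
    let v' : Matrix (Fin N) (Fin N) F := 1 + vecMulVec (Pi.single κ 1) d
    have hu' : IsUnipUpper u' := by
      refine IsUnipUpper.one_add fun i j hij => ?_
      rw [vecMulVec_apply]
      by_cases h : j = r
      · subst h
        simp [c, not_lt.2 hij]
      · simp [h]
    have hv' : IsUnipUpper v' := by
      refine IsUnipUpper.one_add fun i j hij => ?_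
      rw [vecMulVec_apply]
      by_cases h : i = κ
      · subst h
        simp [d, not_lt.2 hij]
      · simp [h]
    have hcK : ∀ i, M i κ + c i * M r κ = if i = r then M r κ else 0 := by
      intro i
      rcases lt_trichotomy i r with h | h | h
      · simp only [c, if_pos h, if_neg h.ne]
        field_simp
        ring
      · subst h; simp [c]
      · simp [c, not_lt.2 h.le, h.ne', hmax i h]
    have hent : ∀ i j, (u' * u * g * (v * v')) i j =
        M i j + c i * M r j + (if i = r then M r κ else 0) * d j := by
      intro i j
      have : u' * u * g * (v * v') = (u' * M) * v' := by
        simp only [hM, Matrix.mul_assoc]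
      have hl : ∀ i j, (u' * M) i j = M i j + c i * M r j := by
        intro i j
        simp [u', Matrix.add_mul, vecMulVec_mul]
        rw [vecMulVec_apply]
        simp
      rw [this, ← hcK i, ← hl, ← hl]
      simp [v', Matrix.mul_add, mul_vecMulVec]
      rw [vecMulVec_apply]
      simp
    refine ⟨u' * u, v * v', hu'.mul hu, hv.mul hv', Function.update p κ r, fun j hj => ?_⟩
    simp only [hent]
    rcases Nat.lt_succ_iff_lt_or_eq.1 hj with hjk | hjk
    · have hjκ : j < κ := hjk
      have hdj : d j = 0 := by simp [d, not_lt.2 hjκ.le]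
      obtain ⟨h1, h2, h3⟩ := hp j hjk
      have hrj : M r j = 0 := h2 r (hrp j hjk)
      have hcp : c (p j) = 0 := by simp [c, h3 κ hjκ.ne']
      rw [Function.update_of_ne hjκ.ne]
      simp only [hdj, hrj, mul_zero, add_zero, if_neg (hrp j hjk).symm, hcp, zero_mul]
      exact ⟨h1, h2, h3⟩
    · obtain rfl : j = κ := Fin.ext hjk
      have hd : d κ = 0 := by simp [d]
      have hcr : c r = 0 := by simp [c]
      rw [Function.update_self]
      refine ⟨?_, fun i hi => ?_, fun l hl => ?_⟩
      · simpa [hd, hcr] using hr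
      · rw [hcK, if_neg hi]; simp
      · rcases lt_or_gt_of_ne hl with h | h
        · have : M r l = 0 := (hp l h).2.1 r (hrp l h)
          simp [this, d, not_lt.2 h.le]
        · simp only [hcr, d, if_pos h, if_true]
          field_simp
          ring

/-- The Bruhat decomposition of `GL_N`. -/
lemma exists_unip_mul_mul_eq_monomial (g : Matrix (Fin N) (Fin N) F) (hg : IsUnit g) :
    ∃ u v : Matrix (Fin N) (Fin N) F, IsUnipUpper u ∧ IsUnipUpper v ∧
      ∃ (p : Fin N → Fin N) (t : Fin N → F), Function.Injective p ∧ (∀ j, t j ≠ 0) ∧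
        ∀ i j, (u * g * v) i j = if i = p j then t j else 0 := by
  obtain ⟨u, v, hu, hv, p, hp⟩ := exists_partial_monomial g hg N le_rfl
  refine ⟨u, v, hu, hv, p, fun j => (u * g * v) (p j) j, ?_, fun j => (hp j j.2).1, ?_⟩
  · intro j l hjl
    by_contra hne
    exact (hp l l.2).1 (hjl ▸ (hp j j.2).2.2 l (Ne.symm hne))
  · intro i j
    split_ifs with h
    · rw [h]
    · exact (hp j j.2).2.1 i h

/-- A permutation in which every descent by one in value between two positions is a descent
between adjacent positions is an involution. -/
lemma involutive_of_descents {α : Type*} (a : Fin N → Fin N) (ha : Function.Injective a)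
    (t : Fin N → α)
    (H : ∀ j k : Fin N, j < k → (a j : ℕ) = a k + 1 → (k : ℕ) = j + 1 ∧ t j = t k) (j : Fin N) :
    a (a j) = j ∧ t (a j) = t j := by
  have hsurj : Function.Surjective a := Finite.surjective_of_injective ha
  suffices key : ∀ k ≤ N, ∃ s, k ≤ s ∧ s ≤ N ∧
      ∀ j : Fin N, (j : ℕ) < s → (a j : ℕ) < s ∧ a (a j) = j ∧ t (a j) = t j by
    obtain ⟨s, hs, -, h⟩ := key N le_rfl
    exact (h j (by omega)).2
  intro k
  induction k with
  | zero => exact fun _ => ⟨0, le_rfl, Nat.zero_le _, fun j hj => absurd hj (by omega)⟩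
  | succ k ih =>
    intro hk
    obtain ⟨s, hks, hsN, hs⟩ := ih (by omega)
    rcases Nat.lt_or_ge k s with hlt | hge
    · exact ⟨s, hlt, hsN, hs⟩
    obtain rfl : s = k := by omega
    let s₀ : Fin N := ⟨s, by omega⟩
    have hse : s ≤ a s₀ := by
      by_contra! h
      obtain ⟨h1, h2, -⟩ := hs (a s₀) h
      rw [ha h2] at h1
      exact lt_irrefl _ h1
    have hblock : ∀ n : ℕ, ∀ j : Fin N, (j : ℕ) = n → s ≤ j → (j : ℕ) ≤ a s₀ →
        (a j : ℕ) + j = s + a s₀ ∧ t j = t s₀ := by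
      intro n
      induction n using Nat.strong_induction_on with
      | _ n ihn =>
        intro j hjn hsj hje
        rcases hsj.eq_or_lt with h | h
        · obtain rfl : j = s₀ := Fin.ext h.symm
          exact ⟨by omega, rfl⟩
        · let i : Fin N := ⟨j - 1, by omega⟩
          obtain ⟨hi1, hi2⟩ := ihn (j - 1) (by omega) i rfl (by simp [i]; omega)
            (by simp [i]; omega)
          have hiv : (i : ℕ) = j - 1 := rfl
          obtain ⟨l, hl⟩ := hsurj ⟨a i - 1, by omega⟩
          have hl' : (a l : ℕ) = a i - 1 := congrArg Fin.val hl
          have hsl : s ≤ l := by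
            by_contra! hls
            have := (hs l hls).1
            omega
          have hil : i < l := by
            by_contra! hli
            have hli' : (l : ℕ) ≤ i := hli
            have := (ihn l (by omega) l rfl hsl (by omega)).1
            omega
          obtain ⟨h1, h2⟩ := H i l hil (by omega)
          obtain rfl : l = j := Fin.ext (by omega)
          exact ⟨by omega, h2.symm.trans hi2⟩
    refine ⟨a s₀ + 1, by omega, (a s₀).2, fun j hj => ?_⟩
    rcases Nat.lt_or_ge j s with h | h
    · have := hs j h
      exact ⟨by omega, this.2⟩
    · obtain ⟨h1, h2⟩ := hblock j j rfl h (by omega)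
      obtain ⟨h3, h4⟩ := hblock (a j) (a j) rfl (by omega) (by omega)
      exact ⟨by omega, Fin.ext (by omega), h4.trans h2.symm⟩

end Bruhat

section GelfandKazhdan

open Matrix

/-- Transposition along the antidiagonal. -/
def antiTranspose {F : Type} {N : ℕ} (A : Matrix (Fin N) (Fin N) F) : Matrix (Fin N) (Fin N) F :=
  Aᵀ.submatrix Fin.rev Fin.rev

lemma antiTranspose_apply {F : Type} {N : ℕ} (A : Matrix (Fin N) (Fin N) F) (i j : Fin N) :
    antiTranspose A i j = A j.rev i.rev := rfl

lemma antiTranspose_antiTranspose {F : Type} {N : ℕ} (A : Matrix (Fin N) (Fin N) F) :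
    antiTranspose (antiTranspose A) = A := by
  ext i j
  simp [antiTranspose_apply]

variable {F : Type} [Field F] {N : ℕ}

lemma antiTranspose_mul (A B : Matrix (Fin N) (Fin N) F) :
    antiTranspose (A * B) = antiTranspose B * antiTranspose A := by
  rw [antiTranspose, Matrix.transpose_mul]
  exact (Matrix.submatrix_mul_equiv Bᵀ Aᵀ _ Fin.revPerm _).symm

lemma antiTranspose_one : antiTranspose (1 : Matrix (Fin N) (Fin N) F) = 1 := by
  ext i j
  simp [antiTranspose_apply, Matrix.one_apply, eq_comm]

lemma IsUnipUpper.antiTranspose {u : Matrix (Fin N) (Fin N) F} (hu : IsUnipUpper u) :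
    IsUnipUpper (antiTranspose u) :=
  ⟨fun i => hu.1 _, fun i j hij => hu.2 _ _ (by simp only [Fin.val_rev]; omega)⟩

lemma psiU_antiTranspose (ψ : AddChar F ℂ) (u : Matrix (Fin N) (Fin N) F) :
    psiU ψ (antiTranspose u) = psiU ψ u := by
  rw [psiU, psiU]
  congr 1
  refine Eq.trans ?_ (Equiv.sum_comp Fin.revPerm _)
  refine Finset.sum_congr rfl fun i _ => ?_
  rw [antiTranspose_apply]
  congr 1 <;> ext <;> simp [Fin.val_rev] <;> omega

/-- Transposition along the antidiagonal, as an operation on `GL_N`. -/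
def antiTransposeGL (g : GL (Fin N) F) : GL (Fin N) F where
  val := antiTranspose (g : Matrix (Fin N) (Fin N) F)
  inv := antiTranspose ((g⁻¹ : GL (Fin N) F) : Matrix (Fin N) (Fin N) F)
  val_inv := by rw [← antiTranspose_mul, Units.inv_mul, antiTranspose_one]
  inv_val := by rw [← antiTranspose_mul, Units.mul_inv, antiTranspose_one]

lemma antiTransposeGL_mul (g h : GL (Fin N) F) :
    antiTransposeGL (g * h) = antiTransposeGL h * antiTransposeGL g :=
  Units.ext (antiTranspose_mul _ _)

lemma antiTransposeGL_one : antiTransposeGL (1 : GL (Fin N) F) = 1 :=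
  Units.ext antiTranspose_one

lemma antiTransposeGL_involutive :
    Function.Involutive (antiTransposeGL : GL (Fin N) F → GL (Fin N) F) :=
  fun _ => Units.ext (antiTranspose_antiTranspose _)

variable [Fintype F]

lemma IsWhittaker.unip_mul {ψ : AddChar F ℂ} {f : GL (Fin N) F → ℂ} (hf : IsWhittaker ψ f)
    {u g h : GL (Fin N) F} (hu : IsUnipUpper (u : Matrix (Fin N) (Fin N) F)) (h' : h = u * g) :
    f h = psiU ψ (u : Matrix (Fin N) (Fin N) F) * f g := by
  rw [h']; exact (hf ⟨u, hu⟩ g).1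

lemma IsWhittaker.mul_unip {ψ : AddChar F ℂ} {f : GL (Fin N) F → ℂ} (hf : IsWhittaker ψ f)
    {u g h : GL (Fin N) F} (hu : IsUnipUpper (u : Matrix (Fin N) (Fin N) F)) (h' : h = g * u) :
    f h = psiU ψ (u : Matrix (Fin N) (Fin N) F) * f g := by
  rw [h']; exact (hf ⟨u, hu⟩ g).2

/-- A monomial matrix in the support of a bi-equivariant function is fixed by the
transposition along the antidiagonal. -/
lemma IsWhittaker.antiTransposeGL_eq_of_monomial {ψ : AddChar F ℂ} (hψ : ψ ≠ 1)
    {f : GL (Fin N) F → ℂ} (hf : IsWhittaker ψ f) {g : GL (Fin N) F} (hg : f g ≠ 0)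
    {p : Fin N → Fin N} {t : Fin N → F} (hp : Function.Injective p) (ht : ∀ j, t j ≠ 0)
    (hgpt : ∀ i j, (g : Matrix (Fin N) (Fin N) F) i j = if i = p j then t j else 0) :
    antiTransposeGL g = g := by
  have hψ' : ∃ x, ψ x ≠ 1 := by
    by_contra! h
    exact hψ (DFunLike.ext _ _ fun x => by simp [h x])
  have key : ∀ j k : Fin N, j < k → (p k : ℕ) = p j + 1 → (k : ℕ) = j + 1 ∧ t j = t k := by
    intro j k hjk hpjk
    have hchar : ∀ x : F, (if (k : ℕ) = j + 1 then ψ x else 1) = ψ (x * t j / t k) := by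
      intro x
      have hv : IsUnipUpper (1 + Matrix.single j k x) := by
        refine IsUnipUpper.one_add fun a b hab => Matrix.single_apply_of_ne _ _ _ _ _ ?_
        rintro ⟨rfl, rfl⟩
        exact absurd hjk (not_lt.2 hab)
      have hu : IsUnipUpper (1 + Matrix.single (p j) (p k) (x * t j / t k)) := by
        refine IsUnipUpper.one_add fun a b hab => Matrix.single_apply_of_ne _ _ _ _ _ ?_
        rintro ⟨rfl, rfl⟩
        have := Fin.le_def.1 hab
        omega
      have hcomm : g * hv.isUnit.unit = hu.isUnit.unit * g := by
        ext a b
        simp only [Units.val_mul, IsUnit.unit_spec, Matrix.mul_add, Matrix.add_mul, Matrix.mul_one,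
          Matrix.one_mul, Matrix.add_apply]
        congr 1
        have h1 : ((g : Matrix (Fin N) (Fin N) F) * Matrix.single j k x) a b =
            if a = p j ∧ b = k then t j * x else 0 := by
          by_cases hb : b = k
          · subst hb
            rw [Matrix.mul_single_apply_same, hgpt]
            by_cases ha : a = p j <;> simp [ha]
          · rw [Matrix.mul_single_apply_of_ne _ _ _ _ _ hb]
            simp [hb]
        have h2 : (Matrix.single (p j) (p k) (x * t j / t k) * (g : Matrix (Fin N) (Fin N) F)) a b =
            if a = p j ∧ b = k then t j * x else 0 := by
          by_cases ha : a = p j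
          · subst ha
            rw [Matrix.single_mul_apply_same, hgpt]
            by_cases hb : b = k
            · subst hb
              have := ht b
              simp
              field_simp
            · simp [hb, hp.ne (Ne.symm hb)]
          · rw [Matrix.single_mul_apply_of_ne _ _ _ _ _ ha]
            simp [ha]
        rw [h1, h2]
      have h1 := hf.mul_unip (u := hv.isUnit.unit) (g := g) hv rfl
      have h2 := hf.unip_mul (u := hu.isUnit.unit) (g := g) hu hcomm
      have h3 := mul_right_cancel₀ hg (h1.symm.trans h2)
      simp only [IsUnit.unit_spec, psiU_one_add_single, if_pos hpjk] at h3
      exact h3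
    have htj := ht j
    have htk := ht k
    obtain ⟨x, hx⟩ := hψ'
    by_cases hkj : (k : ℕ) = j + 1
    · refine ⟨hkj, ?_⟩
      by_contra hne
      have hne' : t k - t j ≠ 0 := sub_ne_zero.2 (Ne.symm hne)
      have h := hchar (x * t k / (t k - t j))
      rw [if_pos hkj] at h
      apply hx
      have hxe : x = x * t k / (t k - t j) - x * t k / (t k - t j) * t j / t k := by
        field_simp
      rw [hxe, AddChar.map_sub_eq_div, ← h, div_self]
      intro h0
      have h2 := AddChar.map_zero_eq_one ψ
      rw [← sub_self (x * t k / (t k - t j)), AddChar.map_sub_eq_div, h0, zero_div] at h2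
      exact zero_ne_one h2
    · have h := hchar (x * t k / t j)
      rw [if_neg hkj] at h
      refine absurd h.symm ?_
      convert hx using 2
      field_simp
  have hinv := involutive_of_descents (fun j => (p j).rev)
    (Fin.rev_injective.comp hp) t (fun j k hjk h => by
      simp only [Fin.val_rev] at h
      exact key j k hjk (by omega))
  ext i j
  change antiTranspose (g : Matrix (Fin N) (Fin N) F) i j = _
  rw [antiTranspose_apply, hgpt, hgpt]
  by_cases h : i = p j
  · have h1 : p i.rev = j.rev := by rw [h, ← Fin.rev_eq_iff]; exact (hinv j).1
    rw [if_pos h1.symm, if_pos h, h]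
    exact (hinv j).2
  · rw [if_neg h, if_neg]
    intro h1
    apply h
    have h2 := (hinv i.rev).1
    simp only [← h1, Fin.rev_rev] at h2
    exact (Fin.rev_injective h2).symm

/-- The Gelfand–Kazhdan invariance: every bi-equivariant function is invariant under the
transposition along the antidiagonal. -/
theorem IsWhittaker.apply_antiTransposeGL {ψ : AddChar F ℂ} (hψ : ψ ≠ 1)
    {f : GL (Fin N) F → ℂ} (hf : IsWhittaker ψ f) (g : GL (Fin N) F) :
    f (antiTransposeGL g) = f g := by
  have main : ∀ g : GL (Fin N) F, f g ≠ 0 → f (antiTransposeGL g) = f g := by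
    intro g hg
    obtain ⟨u, v, hu, hv, p, t, hp, ht, hgpt⟩ :=
      exists_unip_mul_mul_eq_monomial (g : Matrix (Fin N) (Fin N) F) g.isUnit
    set U := hu.isUnit.unit with hU
    set V := hv.isUnit.unit with hV
    have hn : f (U * g * V) = psiU ψ v * (psiU ψ u * f g) := by
      rw [hf.mul_unip (u := V) hv rfl, hf.unip_mul (u := U) hu rfl]
      rfl
    have hn0 : f (U * g * V) ≠ 0 := by
      rw [hn]
      exact mul_ne_zero (psiU_ne_zero _ _) (mul_ne_zero (psiU_ne_zero _ _) hg)
    have hfix := hf.antiTransposeGL_eq_of_monomial hψ hn0 hp ht hgpt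
    have hτ : f (antiTransposeGL (U * g * V)) =
        psiU ψ v * (psiU ψ u * f (antiTransposeGL g)) := by
      rw [antiTransposeGL_mul, antiTransposeGL_mul,
        hf.unip_mul (u := antiTransposeGL V) hv.antiTranspose rfl,
        hf.mul_unip (u := antiTransposeGL U) hu.antiTranspose rfl]
      change psiU ψ (antiTranspose v) * (psiU ψ (antiTranspose u) * _) = _
      rw [psiU_antiTranspose, psiU_antiTranspose]
    rw [hfix, hn] at hτ
    exact (mul_left_cancel₀ (psiU_ne_zero ψ u)
      (mul_left_cancel₀ (psiU_ne_zero ψ v) hτ)).symm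
  by_cases hg : f g = 0
  · by_contra h
    rw [hg] at h
    have := main _ h
    rw [antiTransposeGL_involutive, hg] at this
    exact h this.symm
  · exact main g hg

end GelfandKazhdan

lemma single_eq_smul {F : Type} [Field F] {N : ℕ} (g : GL (Fin N) F) (c : ℂ) :
    MonoidAlgebra.single g c = c • MonoidAlgebra.single g (1 : ℂ) := by
  rw [MonoidAlgebra.smul_single, smul_eq_mul, mul_one]

section WhittakerAlgebra

variable {F : Type} [Field F] [Fintype F] {N : ℕ}

/-- The idempotent of the group algebra attached to the character `ψ` of the unitriangular
group. -/
def whittakerIdem (ψ : AddChar F ℂ) : MonoidAlgebra ℂ (GL (Fin N) F) :=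
  (Fintype.card (unipSubgroup F N) : ℂ)⁻¹ •
    ∑ u : unipSubgroup F N, MonoidAlgebra.single (u : GL (Fin N) F) (whittakerChar ψ u)⁻¹

lemma card_unipSubgroup_ne_zero : (Fintype.card (unipSubgroup F N) : ℂ) ≠ 0 := by
  exact_mod_cast Fintype.card_ne_zero

lemma single_mul_whittakerIdem (ψ : AddChar F ℂ) (u : unipSubgroup F N) :
    MonoidAlgebra.single (u : GL (Fin N) F) 1 * whittakerIdem ψ =
      whittakerChar ψ u • whittakerIdem ψ := by
  rw [whittakerIdem, mul_smul_comm, smul_comm (whittakerChar ψ u)]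
  congr 1
  rw [Finset.mul_sum, Finset.smul_sum]
  refine Eq.trans ?_ (Equiv.sum_comp (Equiv.mulLeft u) _)
  refine Finset.sum_congr rfl fun v _ => ?_
  have := whittakerChar_ne_zero ψ u
  simp only [MonoidAlgebra.single_mul_single, Equiv.coe_mulLeft, Subgroup.coe_mul, map_mul,
    MonoidAlgebra.smul_single, smul_eq_mul]
  congr 1
  field_simp

lemma whittakerIdem_mul_single (ψ : AddChar F ℂ) (u : unipSubgroup F N) :
    whittakerIdem ψ * MonoidAlgebra.single (u : GL (Fin N) F) 1 =
      whittakerChar ψ u • whittakerIdem ψ := by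
  rw [whittakerIdem, smul_mul_assoc, smul_comm (whittakerChar ψ u)]
  congr 1
  rw [Finset.sum_mul, Finset.smul_sum]
  refine Eq.trans ?_ (Equiv.sum_comp (Equiv.mulRight u) _)
  refine Finset.sum_congr rfl fun v _ => ?_
  have := whittakerChar_ne_zero ψ u
  simp only [MonoidAlgebra.single_mul_single, Equiv.coe_mulRight, Subgroup.coe_mul, map_mul,
    MonoidAlgebra.smul_single, smul_eq_mul]
  congr 1
  field_simp

lemma whittakerIdem_mul_of_forall (ψ : AddChar F ℂ) {a : MonoidAlgebra ℂ (GL (Fin N) F)}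
    (ha : ∀ u : unipSubgroup F N,
      MonoidAlgebra.single (u : GL (Fin N) F) 1 * a = whittakerChar ψ u • a) :
    whittakerIdem ψ * a = a := by
  rw [whittakerIdem, smul_mul_assoc, Finset.sum_mul, Finset.sum_congr rfl (g := fun _ => a)]
  · rw [Finset.sum_const, Finset.card_univ, ← Nat.cast_smul_eq_nsmul ℂ, smul_smul,
      inv_mul_cancel₀ card_unipSubgroup_ne_zero, one_smul]
  · intro u _
    rw [single_eq_smul, smul_mul_assoc, ha, smul_smul, inv_mul_cancel₀ (whittakerChar_ne_zero ψ u),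
      one_smul]

lemma mul_whittakerIdem_of_forall (ψ : AddChar F ℂ) {a : MonoidAlgebra ℂ (GL (Fin N) F)}
    (ha : ∀ u : unipSubgroup F N,
      a * MonoidAlgebra.single (u : GL (Fin N) F) 1 = whittakerChar ψ u • a) :
    a * whittakerIdem ψ = a := by
  rw [whittakerIdem, mul_smul_comm, Finset.mul_sum, Finset.sum_congr rfl (g := fun _ => a)]
  · rw [Finset.sum_const, Finset.card_univ, ← Nat.cast_smul_eq_nsmul ℂ, smul_smul,
      inv_mul_cancel₀ card_unipSubgroup_ne_zero, one_smul]
  · intro u _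
    rw [single_eq_smul, mul_smul_comm, ha, smul_smul, inv_mul_cancel₀ (whittakerChar_ne_zero ψ u),
      one_smul]

lemma whittakerIdem_mul_self (ψ : AddChar F ℂ) :
    (whittakerIdem ψ : MonoidAlgebra ℂ (GL (Fin N) F)) * whittakerIdem ψ = whittakerIdem ψ :=
  whittakerIdem_mul_of_forall ψ (single_mul_whittakerIdem ψ)

lemma isWhittaker_coeff_inv (ψ : AddChar F ℂ) {a : MonoidAlgebra ℂ (GL (Fin N) F)}
    (ha : whittakerIdem ψ * a * whittakerIdem ψ = a) :
    IsWhittaker ψ (fun g => a.coeff g⁻¹) := by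
  have hl : ∀ u : unipSubgroup F N,
      MonoidAlgebra.single (u : GL (Fin N) F) 1 * a = whittakerChar ψ u • a := by
    intro u
    rw [← ha, ← mul_assoc, ← mul_assoc, single_mul_whittakerIdem, smul_mul_assoc, smul_mul_assoc]
  have hr : ∀ u : unipSubgroup F N,
      a * MonoidAlgebra.single (u : GL (Fin N) F) 1 = whittakerChar ψ u • a := by
    intro u
    rw [← ha, mul_assoc, whittakerIdem_mul_single, mul_smul_comm]
  intro u g
  constructor
  · have := congrArg (fun b => b.coeff g⁻¹) (hr u)
    simpa [MonoidAlgebra.coeff_mul_single_apply] using this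
  · have := congrArg (fun b => b.coeff g⁻¹) (hl u)
    simpa [MonoidAlgebra.coeff_single_mul_apply] using this

/-- The anti-automorphism of the group algebra induced by the transposition along the
antidiagonal. -/
def antiTransposeAlg :
    MonoidAlgebra ℂ (GL (Fin N) F) →ₐ[ℂ] (MonoidAlgebra ℂ (GL (Fin N) F))ᵐᵒᵖ :=
  MonoidAlgebra.lift ℂ _ _
    { toFun := fun g => MulOpposite.op (MonoidAlgebra.single (antiTransposeGL g) 1)
      map_one' := by rw [antiTransposeGL_one]; rfl
      map_mul' := fun g h => by
        rw [antiTransposeGL_mul, ← MulOpposite.op_mul, MonoidAlgebra.single_mul_single, one_mul] }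

lemma antiTransposeAlg_eq_op {ψ : AddChar F ℂ} (hψ : ψ ≠ 1)
    {a : MonoidAlgebra ℂ (GL (Fin N) F)} (ha : whittakerIdem ψ * a * whittakerIdem ψ = a) :
    antiTransposeAlg a = MulOpposite.op a := by
  classical
  have hcoeff : ∀ g, a.coeff (antiTransposeGL g) = a.coeff g := by
    intro g
    have h : ((antiTransposeGL g⁻¹)⁻¹ : GL (Fin N) F) = antiTransposeGL g := by
      rw [inv_eq_iff_mul_eq_one, ← antiTransposeGL_mul, mul_inv_cancel, antiTransposeGL_one]
    have := (isWhittaker_coeff_inv ψ ha).apply_antiTransposeGL hψ g⁻¹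
    simpa only [h, inv_inv] using this
  have hsum : ∑ g : GL (Fin N) F, MonoidAlgebra.single g (a.coeff g) = a := by
    conv_rhs => rw [← MonoidAlgebra.sum_coeff_single a]
    rw [Finsupp.sum_fintype _ _ (fun g => MonoidAlgebra.single_zero g)]
  conv_rhs => rw [← hsum]
  rw [antiTransposeAlg, MonoidAlgebra.lift_apply, Finsupp.sum_fintype _ _ (by simp)]
  rw [← Equiv.sum_comp (antiTransposeGL_involutive (F := F) (N := N)).toPerm
    (fun g => MonoidAlgebra.single g (a.coeff g))]
  refine Eq.trans ?_ (map_sum MulOpposite.opAddEquiv _ _).symm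
  refine Finset.sum_congr rfl fun g _ => ?_
  rw [Function.Involutive.coe_toPerm, hcoeff, single_eq_smul _ (a.coeff g)]
  rfl

/-- The Hecke algebra of the Gelfand–Graev representation is commutative. -/
theorem whittakerIdem_corner_comm {ψ : AddChar F ℂ} (hψ : ψ ≠ 1)
    (x y : MonoidAlgebra ℂ (GL (Fin N) F)) :
    (whittakerIdem ψ * x * whittakerIdem ψ) * (whittakerIdem ψ * y * whittakerIdem ψ) =
      (whittakerIdem ψ * y * whittakerIdem ψ) * (whittakerIdem ψ * x * whittakerIdem ψ) := by
  set e := whittakerIdem (N := N) ψ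
  have he : e * e = e := whittakerIdem_mul_self ψ
  have hee : ∀ z, e * (e * z) = e * z := fun z => by rw [← mul_assoc, he]
  have h1 := antiTransposeAlg_eq_op hψ (a := e * x * e) (by simp only [mul_assoc, he, hee, e])
  have h2 := antiTransposeAlg_eq_op hψ (a := e * y * e) (by simp only [mul_assoc, he, hee, e])
  have h3 := antiTransposeAlg_eq_op hψ (a := e * x * e * (e * y * e))
    (by simp only [mul_assoc, he, hee, e])
  rw [map_mul, h1, h2, ← MulOpposite.op_mul] at h3
  exact (MulOpposite.op_injective h3).symm

end WhittakerAlgebra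

section CornerBlock

variable {F : Type} [Field F]

lemma Fin.sum_univ_of_add_eq {α : Type*} [AddCommMonoid α] {a b n : ℕ} (h : a + b = n)
    (φ : Fin n → α) :
    ∑ i, φ i = ∑ i : Fin a, φ ⟨i, by omega⟩ + ∑ i : Fin b, φ ⟨a + i, by omega⟩ := by
  subst h
  exact Fin.sum_univ_add φ

/-- The block diagonal matrix `diag(u, I_{n-m})`. -/
def upperLeftBlock (n m : ℕ) (u : Matrix (Fin m) (Fin m) F) : Matrix (Fin n) (Fin n) F :=
  fun i j =>
    if hi : (i : ℕ) < m then (if hj : (j : ℕ) < m then u ⟨i, hi⟩ ⟨j, hj⟩ else 0)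
    else if (i : ℕ) = j then 1 else 0

/-- The block diagonal matrix `diag(I_{n-m}, u)`. -/
def lowerRightBlock (n m : ℕ) (u : Matrix (Fin m) (Fin m) F) : Matrix (Fin n) (Fin n) F :=
  fun i j =>
    if (i : ℕ) < n - m then (if (i : ℕ) = j then 1 else 0)
    else if hi : (i : ℕ) - (n - m) < m then
      (if hj : n - m ≤ (j : ℕ) ∧ (j : ℕ) - (n - m) < m then
        u ⟨(i : ℕ) - (n - m), hi⟩ ⟨(j : ℕ) - (n - m), hj.2⟩ else 0)
    else 0

lemma IsUnipUpper.upperLeftBlock {n m : ℕ} {u : Matrix (Fin m) (Fin m) F}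
    (hu : IsUnipUpper u) : IsUnipUpper (upperLeftBlock n m u) := by
  constructor
  · intro i
    by_cases h : (i : ℕ) < m <;> simp [_root_.upperLeftBlock, h, hu.1]
  · intro i j hij
    by_cases h : (i : ℕ) < m
    · have hj : (j : ℕ) < m := by omega
      simp only [_root_.upperLeftBlock, dif_pos h, dif_pos hj]
      exact hu.2 _ _ hij
    · simp [_root_.upperLeftBlock, h, hij.ne']

lemma IsUnipUpper.lowerRightBlock {n m : ℕ} (hmn : m < n) {u : Matrix (Fin m) (Fin m) F}
    (hu : IsUnipUpper u) : IsUnipUpper (lowerRightBlock n m u) := by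
  constructor
  · intro i
    by_cases h : (i : ℕ) < n - m
    · simp [_root_.lowerRightBlock, h]
    · have h1 : (i : ℕ) - (n - m) < m := by omega
      simp only [_root_.lowerRightBlock, if_neg h, dif_pos h1, dif_pos (And.intro (not_lt.1 h) h1)]
      exact hu.1 _
  · intro i j hij
    by_cases h : (i : ℕ) < n - m
    · simp [_root_.lowerRightBlock, h, hij.ne']
    · have h1 : (i : ℕ) - (n - m) < m := by omega
      simp only [_root_.lowerRightBlock, if_neg h, dif_pos h1]
      split_ifs with h2
      · exact hu.2 _ _ (by simp only; omega)
      · rfl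

lemma psiU_upperLeftBlock (ψ : AddChar F ℂ) {n m : ℕ} (hm : 1 ≤ m) (hmn : m < n)
    (u : Matrix (Fin m) (Fin m) F) : psiU ψ (upperLeftBlock n m u) = psiU ψ u := by
  rw [psiU, psiU]
  congr 1
  rw [Fin.sum_univ_of_add_eq (show (m - 1) + (n - m) = n - 1 by omega)]
  refine (congrArg₂ (· + ·) ?_ ?_).trans (add_zero _)
  · refine Finset.sum_congr rfl fun i _ => ?_
    have h1 : (i : ℕ) < m := by omega
    have h2 : (i : ℕ) + 1 < m := by omega
    simp only [upperLeftBlock, dif_pos h1, dif_pos h2]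
  · refine Finset.sum_eq_zero fun i _ => ?_
    simp only [upperLeftBlock]
    split_ifs <;> first | rfl | omega

lemma psiU_lowerRightBlock (ψ : AddChar F ℂ) {n m : ℕ} (hm : 1 ≤ m) (hmn : m < n)
    (u : Matrix (Fin m) (Fin m) F) : psiU ψ (lowerRightBlock n m u) = psiU ψ u := by
  rw [psiU, psiU]
  congr 1
  rw [Fin.sum_univ_of_add_eq (show (n - m) + (m - 1) = n - 1 by omega)]
  refine (congrArg₂ (· + ·) ?_ ?_).trans (zero_add _)
  · refine Finset.sum_eq_zero fun i _ => ?_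
    have h1 : (i : ℕ) < n - m := i.2
    have h2 : (i : ℕ) ≠ i + 1 := by omega
    simp only [lowerRightBlock, if_pos h1, if_neg h2]
  · refine Finset.sum_congr rfl fun i _ => ?_
    have h1 : ¬ (n - m + i < n - m) := by omega
    have h2 : n - m + i - (n - m) = i := by omega
    have h3 : n - m + i + 1 - (n - m) = i + 1 := by omega
    have h4 : (i : ℕ) < m := by omega
    have h5 : n - m ≤ n - m + i + 1 ∧ (i : ℕ) + 1 < m := by omega
    simp only [lowerRightBlock, if_neg h1, h2, h3, dif_pos h4, dif_pos h5]

lemma cornerBlock_mul {n m : ℕ} (hmn : m < n) (h u : Matrix (Fin m) (Fin m) F) :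
    cornerBlock F n m 1 (h * u) = cornerBlock F n m 1 h * upperLeftBlock n m u := by
  ext i j
  rw [Matrix.mul_apply]
  by_cases hi : (i : ℕ) < n - m
  · rw [Finset.sum_eq_single ⟨i + m, by omega⟩]
    · simp only [cornerBlock, if_pos hi, upperLeftBlock, eq_comm]
      simp
    · intro k _ hk
      have : (k : ℕ) ≠ i + m := fun h => hk (Fin.ext h)
      simp [cornerBlock, hi, this]
    · simp
  · have hi' : (i : ℕ) - (n - m) < m := by omega
    rw [Fin.sum_univ_of_add_eq (show m + (n - m) = n by omega)]
    simp only [cornerBlock, if_neg hi, dif_pos hi', upperLeftBlock]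
    by_cases hj : (j : ℕ) < m
    · simp [hj, Matrix.mul_apply]
    · simp [hj]

lemma cornerBlock_mul' {n m : ℕ} (hmn : m < n) (u h : Matrix (Fin m) (Fin m) F) :
    cornerBlock F n m 1 (u * h) = lowerRightBlock n m u * cornerBlock F n m 1 h := by
  ext i j
  rw [Matrix.mul_apply]
  by_cases hi : (i : ℕ) < n - m
  · rw [Finset.sum_eq_single i]
    · simp [cornerBlock, hi, lowerRightBlock]
    · intro k _ hk
      have : (i : ℕ) ≠ k := fun h => hk (Fin.ext h.symm)
      simp [lowerRightBlock, hi, this]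
    · simp
  · have hi' : (i : ℕ) - (n - m) < m := by omega
    rw [Fin.sum_univ_of_add_eq (show (n - m) + m = n by omega)]
    simp only [cornerBlock, if_neg hi, dif_pos hi', lowerRightBlock]
    by_cases hj : (j : ℕ) < m
    · simp only [hj, Matrix.mul_apply, dif_pos]
      simp
      refine Finset.sum_eq_zero fun x _ => ?_
      simp [show ¬ n ≤ x + m by omega]
    · simp [hj]
      refine (Finset.sum_eq_zero fun x _ => ?_).symm
      simp [show ¬ n ≤ x + m by omega]

variable [Fintype F]

lemma isWhittaker_Bessel_cornerBlock (ψ : AddChar F ℂ) {n m : ℕ} (hm : 1 ≤ m) (hmn : m < n)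
    (π : FinRep n F) :
    IsWhittaker ψ (fun h : GL (Fin m) F =>
      Bessel ψ π (cornerBlock F n m 1 (h : Matrix (Fin m) (Fin m) F))) := by
  rintro ⟨u, hu⟩ g
  rw [mem_unipSubgroup] at hu
  constructor
  · have hu' := hu.lowerRightBlock hmn
    have := Bessel_unip_mul ψ π (cornerBlock F n m 1 (g : Matrix (Fin m) (Fin m) F))
      ⟨hu'.isUnit.unit, hu'⟩
    simp only [Units.val_mul, cornerBlock_mul' hmn]
    refine this.trans ?_
    congr 1
    exact psiU_lowerRightBlock ψ hm hmn _
  · have hu' := hu.upperLeftBlock (n := n)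
    have := Bessel_mul_unip ψ π (cornerBlock F n m 1 (g : Matrix (Fin m) (Fin m) F))
      ⟨hu'.isUnit.unit, hu'⟩
    simp only [Units.val_mul, cornerBlock_mul hmn]
    refine this.trans ?_
    congr 1
    exact psiU_upperLeftBlock ψ hm hmn _

end CornerBlock

namespace FinRep

open Matrix

variable {F : Type} [Field F] {N : ℕ}

lemma algHom_eq_zero_of_iso {σ τ : FinRep N F} (h : τ.Iso σ)
    {a : MonoidAlgebra ℂ (GL (Fin N) F)} (ha : σ.algHom a = 0) : τ.algHom a = 0 := by
  obtain ⟨e, he⟩ := h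
  have key : ∀ x v, e (τ.algHom x *ᵥ v) = σ.algHom x *ᵥ e v := by
    intro x v
    induction x using MonoidAlgebra.induction_linear with
    | zero => simp
    | add x y hx hy => simp [add_mulVec, hx, hy]
    | single g c => simp [smul_mulVec, he]
  refine Matrix.toLin'.injective (LinearMap.ext fun v => e.injective ?_)
  simp [key, ha]

lemma algHom_mulVec_mem {τ : FinRep N F} {W : Submodule ℂ (Fin τ.d → ℂ)}
    (hW : ∀ g : GL (Fin N) F, ∀ v ∈ W, (τ.ρ g : Matrix (Fin τ.d) (Fin τ.d) ℂ) *ᵥ v ∈ W)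
    (a : MonoidAlgebra ℂ (GL (Fin N) F)) {v : Fin τ.d → ℂ} (hv : v ∈ W) :
    τ.algHom a *ᵥ v ∈ W := by
  induction a using MonoidAlgebra.induction_linear with
  | zero => simp
  | add x y hx hy => rw [map_add, add_mulVec]; exact add_mem hx hy
  | single g c => rw [algHom_single, smul_mulVec]; exact W.smul_mem c (hW g v hv)

/-- A simple module over the group algebra yields an irreducible representation. -/
lemma exists_irreducible_of_isSimpleModule (M : Type*) [AddCommGroup M] [Module ℂ M]
    [Module (MonoidAlgebra ℂ (GL (Fin N) F)) M]
    [IsScalarTower ℂ (MonoidAlgebra ℂ (GL (Fin N) F)) M] [Module.Finite ℂ M]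
    [IsSimpleModule (MonoidAlgebra ℂ (GL (Fin N) F)) M] :
    ∃ τ : FinRep N F, τ.Irreducible ∧ ∀ a, τ.algHom a = 0 → ∀ x : M, a • x = 0 := by
  let b := Module.finBasis ℂ M
  let φ : MonoidAlgebra ℂ (GL (Fin N) F) →ₐ[ℂ] Matrix _ _ ℂ :=
    (LinearMap.toMatrixAlgEquiv b).toAlgHom.comp (Algebra.lsmul ℂ ℂ M)
  let τ : FinRep N F :=
    { d := Module.finrank ℂ M
      ρ := MonoidHom.toHomUnits (φ.toMonoidHom.comp (MonoidAlgebra.of ℂ (GL (Fin N) F))) }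
  have hφ : ∀ a, τ.algHom a = φ a := by
    intro a
    induction a using MonoidAlgebra.induction_linear with
    | zero => rw [map_zero, map_zero]
    | add x y hx hy => rw [map_add, map_add, hx, hy]
    | single g c =>
      rw [algHom_single, ← mul_one c, ← smul_eq_mul c, ← MonoidAlgebra.smul_single, map_smul,
        smul_eq_mul, mul_one]
      rfl
  have hrepr : ∀ a (x : M), φ a *ᵥ b.equivFun x = b.equivFun (a • x) := fun a x =>
    LinearMap.toMatrix_mulVec_repr b b (Algebra.lsmul ℂ ℂ M a) x
  have hnt : Nontrivial M := IsSimpleModule.nontrivial (MonoidAlgebra ℂ (GL (Fin N) F)) M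
  refine ⟨τ, ⟨Module.finrank_pos, fun W hW => ?_⟩, fun a ha x => ?_⟩
  · let W' : Submodule (MonoidAlgebra ℂ (GL (Fin N) F)) M :=
      { carrier := {x | b.equivFun x ∈ W}
        add_mem' := fun {x y} hx hy => by
          change b.equivFun (x + y) ∈ W
          rw [map_add]
          exact add_mem hx hy
        zero_mem' := by
          change b.equivFun 0 ∈ W
          rw [map_zero]
          exact W.zero_mem
        smul_mem' := fun a x hx => by
          have := algHom_mulVec_mem hW a hx
          rw [hφ] at this
          change b.equivFun (a • x) ∈ W
          rw [← hrepr]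
          exact this }
    rcases eq_bot_or_eq_top W' with h | h
    · left
      refine (Submodule.eq_bot_iff _).2 fun v hv => ?_
      have : b.equivFun.symm v ∈ W' := by
        change b.equivFun (b.equivFun.symm v) ∈ W
        rwa [LinearEquiv.apply_symm_apply]
      rw [h, Submodule.mem_bot] at this
      exact b.equivFun.symm.map_eq_zero_iff.1 this
    · right
      refine eq_top_iff.2 fun v _ => ?_
      have : b.equivFun.symm v ∈ W' := h ▸ Submodule.mem_top
      change b.equivFun (b.equivFun.symm v) ∈ W at this
      rwa [LinearEquiv.apply_symm_apply] at this
  · refine b.equivFun.map_eq_zero_iff.1 ?_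
    rw [← hrepr, ← hφ, ha]
    exact zero_mulVec _

/-- The irreducible representations separate the elements of the group algebra. -/
lemma eq_zero_of_forall_irreducible [Fintype F] {a : MonoidAlgebra ℂ (GL (Fin N) F)}
    (h : ∀ τ : FinRep N F, τ.Irreducible → τ.algHom a = 0) : a = 0 := by
  classical
  have : Module.Finite ℂ (MonoidAlgebra ℂ (GL (Fin N) F)) :=
    Module.Finite.equiv (MonoidAlgebra.coeffLinearEquiv ℂ).symm
  have hmem : a ∈ (⊤ : Submodule (MonoidAlgebra ℂ (GL (Fin N) F))
      (MonoidAlgebra ℂ (GL (Fin N) F))).annihilator := by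
    rw [← IsSemisimpleModule.sSup_simples_eq_top, sSup_eq_iSup', Submodule.annihilator_iSup,
      Submodule.mem_iInf]
    rintro ⟨S, hS⟩
    have hS' : IsSimpleModule (MonoidAlgebra ℂ (GL (Fin N) F)) S := hS
    have : Module.Finite ℂ S := inferInstanceAs (Module.Finite ℂ (S.restrictScalars ℂ))
    obtain ⟨τ, hτ, hτS⟩ := exists_irreducible_of_isSimpleModule (F := F) (N := N) S
    exact Submodule.mem_annihilator.2 fun s hs => congrArg Subtype.val (hτS a (h τ hτ) ⟨s, hs⟩)
  simpa using Submodule.mem_annihilator.1 hmem 1 Submodule.mem_top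

end FinRep

namespace FinRep

open Matrix

variable {F : Type} [Field F] [Fintype F] {N : ℕ}

lemma algHom_whittakerIdem (ψ : AddChar F ℂ) (τ : FinRep N F) :
    τ.algHom (whittakerIdem ψ) = (Fintype.card (unipSubgroup F N) : ℂ)⁻¹ •
      ∑ u : unipSubgroup F N, (whittakerChar ψ u)⁻¹ •
        (τ.ρ (u : GL (Fin N) F) : Matrix (Fin τ.d) (Fin τ.d) ℂ) := by
  rw [whittakerIdem, map_smul, map_sum]
  simp only [algHom_single]

lemma Bessel_eq_trace (ψ : AddChar F ℂ) (τ : FinRep N F) (g : GL (Fin N) F) :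
    Bessel ψ τ (g : Matrix (Fin N) (Fin N) F) =
      Matrix.trace ((τ.ρ g : Matrix (Fin τ.d) (Fin τ.d) ℂ) * τ.algHom (whittakerIdem ψ)) := by
  rw [algHom_whittakerIdem, Bessel_eq, Matrix.mul_smul, Matrix.trace_smul, Matrix.mul_sum,
    Matrix.trace_sum, smul_eq_mul]
  congr 1
  refine Finset.sum_congr rfl fun u _ => ?_
  rw [← Units.val_mul, traceChar_coe, Matrix.mul_smul, Matrix.trace_smul, smul_eq_mul, map_mul,
    Units.val_mul]

lemma conj_Bessel (ψ : AddChar F ℂ) (τ : FinRep N F) (g : GL (Fin N) F) :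
    (starRingEnd ℂ) (Bessel ψ τ (g : Matrix (Fin N) (Fin N) F)) =
      Bessel ψ τ ((g⁻¹ : GL (Fin N) F) : Matrix (Fin N) (Fin N) F) := by
  classical
  rw [Bessel_eq, Bessel_eq, map_mul, map_inv₀, Complex.conj_natCast, map_sum]
  congr 1
  refine Eq.trans ?_ (Equiv.sum_comp (Equiv.inv _) _)
  refine Finset.sum_congr rfl fun u _ => ?_
  rw [map_mul, map_inv₀, conj_whittakerChar, Equiv.inv_apply, map_inv, ← Units.val_mul,
    traceChar_coe, ← trace_inv, ← traceChar_mul_comm, Subgroup.coe_inv, ← Units.val_mul,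
    traceChar_coe, _root_.mul_inv_rev]

/-- Genericity means that the idempotent attached to `ψ` acts nontrivially. -/
lemma generic_iff_algHom_ne_zero (ψ : AddChar F ℂ) (τ : FinRep N F) :
    τ.Generic ψ ↔ τ.algHom (whittakerIdem ψ) ≠ 0 := by
  constructor
  · rintro ⟨ℓ, hℓ, h⟩ h0
    refine hℓ (LinearMap.ext fun v => ?_)
    have key : ℓ (τ.algHom (whittakerIdem ψ) *ᵥ v) = ℓ v := by
      rw [algHom_whittakerIdem, smul_mulVec, Matrix.sum_mulVec, map_smul, map_sum,
        Finset.sum_congr rfl (g := fun _ => ℓ v)]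
      · rw [Finset.sum_const, Finset.card_univ, nsmul_eq_mul, smul_eq_mul,
          inv_mul_cancel_left₀ card_unipSubgroup_ne_zero]
      · intro u _
        rw [smul_mulVec, map_smul, h _ u.2, smul_eq_mul]
        exact inv_mul_cancel_left₀ (whittakerChar_ne_zero ψ u) _
    rw [← key, h0, zero_mulVec, map_zero, LinearMap.zero_apply]
  · intro h
    obtain ⟨i, hi⟩ := Function.ne_iff.1 h
    refine ⟨(LinearMap.proj i).comp (τ.algHom (whittakerIdem ψ)).mulVecLin, ?_, ?_⟩
    · intro h0
      refine hi (funext fun j => ?_)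
      simpa using LinearMap.congr_fun h0 (Pi.single j 1)
    · intro u hu v
      have := congrArg τ.algHom (whittakerIdem_mul_single ψ (⟨u, hu⟩ : unipSubgroup F N))
      rw [map_mul, algHom_single, one_smul, map_smul] at this
      simp only [LinearMap.comp_apply, mulVecLin_apply, mulVec_mulVec, LinearMap.proj_apply]
      rw [this, smul_mulVec]
      rfl

end FinRep

namespace FinRep

open Matrix

variable {F : Type} [Field F] [Fintype F] {N : ℕ} {ψ : AddChar F ℂ}

lemma Irreducible.exists_algHom_whittakerIdem (hψ : ψ ≠ 1) {τ : FinRep N F}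
    (hτ : τ.Irreducible) (hg : τ.Generic ψ) :
    ∃ w l : Fin τ.d → ℂ, τ.algHom (whittakerIdem ψ) = vecMulVec w l ∧ l ⬝ᵥ w = 1 :=
  hτ.exists_algHom_eq_vecMulVec (whittakerIdem_mul_self ψ) (whittakerIdem_corner_comm hψ)
    ((generic_iff_algHom_ne_zero ψ τ).1 hg)

lemma Bessel_eq_dotProduct {τ : FinRep N F} {w l : Fin τ.d → ℂ}
    (h : τ.algHom (whittakerIdem ψ) = vecMulVec w l) (g : GL (Fin N) F) :
    Bessel ψ τ (g : Matrix (Fin N) (Fin N) F) =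
      l ⬝ᵥ ((τ.ρ g : Matrix (Fin τ.d) (Fin τ.d) ℂ) *ᵥ w) := by
  rw [Bessel_eq_trace, h, mul_vecMulVec, trace_vecMulVec, dotProduct_comm]

variable [DecidableEq F]

lemma sum_Bessel_mul_Bessel_inv {σ τ : FinRep N F} {w l : Fin τ.d → ℂ} {w' l' : Fin σ.d → ℂ}
    (h : τ.algHom (whittakerIdem ψ) = vecMulVec w l)
    (h' : σ.algHom (whittakerIdem ψ) = vecMulVec w' l') :
    ∑ g : GL (Fin N) F, Bessel ψ τ (g : Matrix (Fin N) (Fin N) F) *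
        Bessel ψ σ ((g⁻¹ : GL (Fin N) F) : Matrix (Fin N) (Fin N) F) =
      l ⬝ᵥ ((∑ g : GL (Fin N) F, (τ.ρ g : Matrix (Fin τ.d) (Fin τ.d) ℂ) * vecMulVec w l' *
        (σ.ρ g⁻¹ : Matrix (Fin σ.d) (Fin σ.d) ℂ)) *ᵥ w') := by
  rw [Matrix.sum_mulVec, dotProduct_sum]
  refine Finset.sum_congr rfl fun g _ => ?_
  rw [Bessel_eq_dotProduct h, Bessel_eq_dotProduct h', ← mulVec_mulVec, mul_vecMulVec,
    vecMulVec_mulVec, op_smul_eq_smul, dotProduct_smul, smul_eq_mul, mul_comm]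

lemma sum_Bessel_mul_Bessel_inv_eq_zero (hψ : ψ ≠ 1) {σ τ : FinRep N F} (hσ : σ.Irreducible)
    (hτ : τ.Irreducible) (hσg : σ.Generic ψ) (hτg : τ.Generic ψ) (hiso : ¬ σ.Iso τ) :
    ∑ g : GL (Fin N) F, Bessel ψ τ (g : Matrix (Fin N) (Fin N) F) *
      Bessel ψ σ ((g⁻¹ : GL (Fin N) F) : Matrix (Fin N) (Fin N) F) = 0 := by
  obtain ⟨w, l, h, -⟩ := hτ.exists_algHom_whittakerIdem hψ hτg
  obtain ⟨w', l', h', -⟩ := hσ.exists_algHom_whittakerIdem hψ hσg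
  rw [sum_Bessel_mul_Bessel_inv h h',
    hσ.intertwiner_eq_zero hτ hiso _ (sum_intertwines σ τ (vecMulVec w l')), zero_mulVec,
    dotProduct_zero]

lemma sum_Bessel_mul_Bessel_inv_self (hψ : ψ ≠ 1) {τ : FinRep N F} (hτ : τ.Irreducible)
    (hτg : τ.Generic ψ) :
    ∑ g : GL (Fin N) F, Bessel ψ τ (g : Matrix (Fin N) (Fin N) F) *
      Bessel ψ τ ((g⁻¹ : GL (Fin N) F) : Matrix (Fin N) (Fin N) F) =
        (Fintype.card (GL (Fin N) F) : ℂ) / τ.d := by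
  obtain ⟨w, l, h, hwl⟩ := hτ.exists_algHom_whittakerIdem hψ hτg
  rw [sum_Bessel_mul_Bessel_inv h h, sum_eq_trace_smul hτ, trace_vecMulVec, dotProduct_comm w,
    hwl, smul_mulVec, one_mulVec, dotProduct_smul, hwl, smul_eq_mul, mul_one, mul_one]

/-- The element of the group algebra attached to a function on the group by `h ↦ f h • h⁻¹`. -/
def ofFun (f : GL (Fin N) F → ℂ) : MonoidAlgebra ℂ (GL (Fin N) F) :=
  ∑ h : GL (Fin N) F, MonoidAlgebra.single h⁻¹ (f h)

lemma coeff_ofFun_inv (f : GL (Fin N) F → ℂ) (g : GL (Fin N) F) : (ofFun f).coeff g⁻¹ = f g := by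
  rw [ofFun, MonoidAlgebra.coeff_sum, Finsupp.finsetSum_apply, Finset.sum_eq_single g]
  · simp
  · intro h _ hne
    simp [hne]
  · simp

lemma _root_.IsWhittaker.corner_ofFun {f : GL (Fin N) F → ℂ} (hf : IsWhittaker ψ f) :
    whittakerIdem ψ * ofFun f * whittakerIdem ψ = ofFun f := by
  rw [whittakerIdem_mul_of_forall, mul_whittakerIdem_of_forall]
  · intro u
    rw [ofFun, Finset.sum_mul, Finset.smul_sum]
    refine (Equiv.sum_comp (Equiv.mulLeft (u : GL (Fin N) F)) _).symm.trans ?_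
    refine Finset.sum_congr rfl fun h _ => ?_
    simp [MonoidAlgebra.single_mul_single, (hf u h).1]
  · intro u
    rw [ofFun, Finset.mul_sum, Finset.smul_sum]
    refine (Equiv.sum_comp (Equiv.mulRight (u : GL (Fin N) F)) _).symm.trans ?_
    refine Finset.sum_congr rfl fun h _ => ?_
    simp [MonoidAlgebra.single_mul_single, (hf u h).2]

lemma trace_algHom_ofFun_mul (τ : FinRep N F) (f : GL (Fin N) F → ℂ) :
    Matrix.trace (τ.algHom (ofFun f) * τ.algHom (whittakerIdem ψ)) =
      ∑ h : GL (Fin N) F, f h *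
        Bessel ψ τ ((h⁻¹ : GL (Fin N) F) : Matrix (Fin N) (Fin N) F) := by
  rw [ofFun, map_sum, Matrix.sum_mul, Matrix.trace_sum]
  refine Finset.sum_congr rfl fun h _ => ?_
  rw [algHom_single, Matrix.smul_mul, Matrix.trace_smul, smul_eq_mul, Bessel_eq_trace]

/-- A bi-equivariant function orthogonal to the Bessel functions of all irreducible generic
representations vanishes. -/
lemma _root_.IsWhittaker.eq_zero_of_sum_mul_Bessel (hψ : ψ ≠ 1) {f : GL (Fin N) F → ℂ}
    (hf : IsWhittaker ψ f) {ι : Type*} (σ : ι → FinRep N F)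
    (hσ : ∀ i, (σ i).Irreducible ∧ (σ i).Generic ψ)
    (hcomplete : ∀ τ : FinRep N F, τ.Irreducible → τ.Generic ψ → ∃ i, τ.Iso (σ i))
    (h0 : ∀ i, ∑ h : GL (Fin N) F, f h *
      Bessel ψ (σ i) ((h⁻¹ : GL (Fin N) F) : Matrix (Fin N) (Fin N) F) = 0) : f = 0 := by
  have hσ0 : ∀ i, (σ i).algHom (ofFun f) = 0 := by
    intro i
    obtain ⟨w, l, hE, hwl⟩ := (hσ i).1.exists_algHom_whittakerIdem hψ (hσ i).2
    obtain ⟨c, hc⟩ := (hσ i).1.exists_algHom_eq_smul (whittakerIdem_mul_self ψ)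
      (whittakerIdem_corner_comm hψ) hf.corner_ofFun
    have := trace_algHom_ofFun_mul (ψ := ψ) (σ i) f
    rw [h0, hc, Matrix.smul_mul, ← map_mul, whittakerIdem_mul_self, hE, Matrix.trace_smul,
      trace_vecMulVec, dotProduct_comm, hwl, smul_eq_mul, mul_one] at this
    rw [hc, this, zero_smul]
  have hzero : ofFun f = 0 := by
    refine eq_zero_of_forall_irreducible fun τ hτ => ?_
    by_cases hg : τ.Generic ψ
    · obtain ⟨i, hi⟩ := hcomplete τ hτ hg
      exact algHom_eq_zero_of_iso hi (hσ0 i)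
    · rw [generic_iff_algHom_ne_zero, not_not] at hg
      rw [← hf.corner_ofFun, map_mul, hg, mul_zero]
  funext g
  rw [← coeff_ofFun_inv f g, hzero]
  rfl

/-- The expansion of a bi-equivariant function in terms of Bessel functions. -/
theorem _root_.IsWhittaker.eq_sum_Bessel (hψ : ψ ≠ 1) {f : GL (Fin N) F → ℂ}
    (hf : IsWhittaker ψ f) {ι : Type*} [Fintype ι] (σ : ι → FinRep N F)
    (hσ : ∀ i, (σ i).Irreducible ∧ (σ i).Generic ψ)
    (hpairwise : ∀ i j, (σ i).Iso (σ j) → i = j)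
    (hcomplete : ∀ τ : FinRep N F, τ.Irreducible → τ.Generic ψ → ∃ i, τ.Iso (σ i))
    (g : GL (Fin N) F) :
    f g = ∑ i, ((σ i).d / (Fintype.card (GL (Fin N) F) : ℂ) *
      ∑ h : GL (Fin N) F, f h * Bessel ψ (σ i) ((h⁻¹ : GL (Fin N) F) : Matrix (Fin N) (Fin N) F)) *
        Bessel ψ (σ i) (g : Matrix (Fin N) (Fin N) F) := by
  set c : ι → ℂ := fun i => (σ i).d / (Fintype.card (GL (Fin N) F) : ℂ) *
      ∑ h : GL (Fin N) F, f h * Bessel ψ (σ i) ((h⁻¹ : GL (Fin N) F) : Matrix (Fin N) (Fin N) F)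
    with hc
  have hf' : IsWhittaker ψ (fun g : GL (Fin N) F =>
      f g - ∑ i, c i * Bessel ψ (σ i) (g : Matrix (Fin N) (Fin N) F)) := by
    intro u g
    have hB := fun i => isWhittaker_Bessel ψ (σ i) u g
    constructor
    · simp only [(hf u g).1, fun i => (hB i).1, mul_sub, Finset.mul_sum, mul_left_comm]
    · simp only [(hf u g).2, fun i => (hB i).2, mul_sub, Finset.mul_sum, mul_left_comm]
  have h0 := hf'.eq_zero_of_sum_mul_Bessel hψ σ hσ hcomplete fun i => by
    simp only [sub_mul, Finset.sum_sub_distrib, Finset.sum_mul]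
    rw [Finset.sum_comm, Finset.sum_eq_single i]
    · simp only [mul_assoc, ← Finset.mul_sum]
      rw [sum_Bessel_mul_Bessel_inv_self hψ (hσ i).1 (hσ i).2, hc]
      have hd : ((σ i).d : ℂ) ≠ 0 := by exact_mod_cast (hσ i).1.1.ne'
      have hG : (Fintype.card (GL (Fin N) F) : ℂ) ≠ 0 := by exact_mod_cast Fintype.card_ne_zero
      field_simp
      ring
    · intro j _ hji
      simp only [mul_assoc, ← Finset.mul_sum]
      rw [sum_Bessel_mul_Bessel_inv_eq_zero hψ (hσ i).1 (hσ j).1 (hσ i).2 (hσ j).2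
        (fun h => hji (hpairwise i j h).symm), mul_zero]
    · simp
  exact sub_eq_zero.1 (congrFun h0 g)

end FinRep
end

/-- a recursive expression for special values of the Bessel function of an
irreducible generic representation `π` of `GL_n(F)` in terms of the Bessel functions of the
irreducible generic representations of `GL_m(F)`, for `1 ≤ m < n`. -/
theorem bessel_recursive_lt
    (F : Type) [Field F] [Fintype F] [DecidableEq F]
    (ψ : AddChar F ℂ) (hψ : ψ ≠ 1)
    (n : ℕ) (hn : 1 < n)
    (π : FinRep n F) (hπirr : π.Irreducible) (hπgen : π.Generic ψ)
    (m : ℕ) (hm : 1 ≤ m) (hmn : m < n)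
    (ι : Type) [Fintype ι] (σ : ι → FinRep m F)
    (hσ : ∀ i, (σ i).Irreducible ∧ (σ i).Generic ψ)
    (hpairwise : ∀ i j, (σ i).Iso (σ j) → i = j)
    (hcomplete : ∀ τ : FinRep m F, τ.Irreducible → τ.Generic ψ → ∃ i, τ.Iso (σ i))
    (g : (Matrix (Fin m) (Fin m) F)ˣ) :
    Bessel ψ π (cornerBlock F n m 1 (g : Matrix (Fin m) (Fin m) F)) =
      (((unipFinset F m).card : ℂ) / (Fintype.card (Matrix (Fin m) (Fin m) F)ˣ : ℂ)) *
        ∑ i : ι, ((σ i).d : ℂ) *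
          (((unipFinset F m).card : ℂ)⁻¹ *
            ∑ h : (Matrix (Fin m) (Fin m) F)ˣ,
              Bessel ψ π (cornerBlock F n m 1 (h : Matrix (Fin m) (Fin m) F)) *
                (starRingEnd ℂ) (Bessel ψ (σ i) (h : Matrix (Fin m) (Fin m) F))) *
          Bessel ψ (σ i) (g : Matrix (Fin m) (Fin m) F) := by
  rw [(isWhittaker_Bessel_cornerBlock ψ hm hmn π).eq_sum_Bessel hψ σ hσ hpairwise hcomplete g,
    Finset.mul_sum]
  refine Finset.sum_congr rfl fun i _ => ?_
  have hU : ((unipFinset F m).card : ℂ) ≠ 0 := by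
    rw [card_unipFinset]
    exact card_unipSubgroup_ne_zero
  simp only [FinRep.conj_Bessel]
  field_simp
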